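/- arXiv:2107.11248 — 6 statements merged into one kernel-verified Lean document; each statement's English description precedes it below -/
import Mathlib

section
/- If $(a_{i,j})$ is an $n\times m$ real matrix with $|a_{i,j}|\le C$ for all $i,j$ and $\sum_{j=1}^m a_{i,j}=0$ for every $i$, then there exist permutations $\sigma_1,\dots,\sigma_n$ of $\{1,\dots,m\}$ such that $|\sum_{i=1}^k a_{i,\sigma_i(j)}| \le 2C$ for all $k=1,\dots,n$ and $j=1,\dots,m$. -/
open Finset

theorem kwapien_step (m : ℕ) (s a : Fin m → ℝ) :
    ∃ σ : Equiv.Perm (Fin m), ∀ i j, s i < s j → a (σ j) ≤ a (σ i) := by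
  refine ⟨(Tuple.sort s).symm.trans (Tuple.sort (fun x => - a x)), fun i j hij => ?_⟩
  have h1 := Tuple.monotone_sort s
  have h2 := Tuple.monotone_sort (fun x => - a x)
  have h3 : (Tuple.sort s).symm i ≤ (Tuple.sort s).symm j := by
    by_contra h
    have := h1 (le_of_lt (not_le.mp h))
    simp at this
    linarith
  have := h2 h3
  simp at this
  simpa using this

theorem kwapien_nat (m : ℕ) (C : ℝ) (hC : 0 ≤ C) (a : ℕ → Fin m → ℝ)
    (hbd : ∀ i j, |a i j| ≤ C) :
    ∃ σ : ℕ → Equiv.Perm (Fin m), ∀ k i j,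
      ∑ x ∈ range k, a x (σ x i) - ∑ x ∈ range k, a x (σ x j) ≤ 2 * C := by
  choose f hf using kwapien_step m
  let s : ℕ → Fin m → ℝ := fun k => Nat.rec (fun _ => 0) (fun k s j => s j + a k (f s (a k) j)) k
  have hs : ∀ k j, s (k+1) j = s k j + a k (f (s k) (a k) j) := fun k j => rfl
  have hS : ∀ k j, ∑ x ∈ range k, a x (f (s x) (a x) j) = s k j := by
    intro k j
    induction k with
    | zero => simp [s]
    | succ k ih => rw [sum_range_succ, ih, hs]
  refine ⟨fun k => f (s k) (a k), fun k => ?_⟩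
  simp only [hS]
  induction k with
  | zero => intro i j; simp [s]; exact hC
  | succ k ih =>
    intro i j
    rw [hs, hs]
    have h1 := abs_le.mp (hbd k (f (s k) (a k) i))
    have h2 := abs_le.mp (hbd k (f (s k) (a k) j))
    have h3 := ih i j
    rcases lt_or_ge (s k j) (s k i) with h | h
    · have := hf (s k) (a k) j i h
      linarith
    · linarith

theorem kwapien_matrix_lemma (n m : ℕ) (hn : 0 < n) (hm : 0 < m)
    (C : ℝ) (hC : 0 ≤ C)
    (a : Fin n → Fin m → ℝ)
    (hbd : ∀ i j, |a i j| ≤ C)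
    (hsum : ∀ i, ∑ j, a i j = 0) :
    ∃ σ : Fin n → Equiv.Perm (Fin m),
      ∀ (k : Fin n) (j : Fin m), |∑ i ∈ Finset.Iic k, a i ((σ i) j)| ≤ 2 * C := by
  obtain ⟨σ, hσ⟩ := kwapien_nat m C hC (fun x j => if h : x < n then a ⟨x, h⟩ j else 0) (by
    intro i j
    split_ifs with h
    · exact hbd _ _
    · simpa using hC)
  refine ⟨fun i => σ i, fun k j => ?_⟩
  have key : ∀ j, ∑ x ∈ range (k.val + 1), (if h : x < n then a ⟨x, h⟩ (σ x j) else 0)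
      = ∑ i ∈ Finset.Iic k, a i (σ i j) := by
    intro j
    have : range (k.val + 1) = (Finset.Iic k).map Fin.valEmbedding := by
      rw [Fin.map_valEmbedding_Iic]
      ext x
      simp
    rw [this, sum_map]
    simp
  have hd : ∀ i j, ∑ x ∈ Finset.Iic k, a x (σ x i) - ∑ x ∈ Finset.Iic k, a x (σ x j) ≤ 2 * C := by
    intro i j
    have := hσ (k.val + 1) i j
    rwa [key, key] at this
  have h0 : ∑ j, ∑ x ∈ Finset.Iic k, a x (σ x j) = 0 := by
    rw [sum_comm]
    refine sum_eq_zero fun x _ => ?_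
    rw [Equiv.sum_comp (σ x) (a x), hsum]
  have hne : (univ : Finset (Fin m)).Nonempty := ⟨⟨0, hm⟩, mem_univ _⟩
  obtain ⟨p, -, hp⟩ := exists_le_of_sum_le (s := univ) (f := fun j => ∑ x ∈ Finset.Iic k, a x (σ x j))
    (g := fun _ => (0 : ℝ)) hne (by simp [h0])
  obtain ⟨q, -, hq⟩ := exists_le_of_sum_le (s := univ) (f := fun _ => (0 : ℝ))
    (g := fun j => ∑ x ∈ Finset.Iic k, a x (σ x j)) hne (by simp [h0])
  have h1 := hd j p
  have h2 := hd q j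
  rw [abs_le]
  constructor <;> linarith
end

section
/- Let $V$ be a $d$-dimensional real normed space and let $a_{i,j}\in V$ for $1\le i\le n$, $1\le j\le m$ satisfy $\|a_{i,j}\|\le 1$ and $\sum_{j=1}^m a_{i,j}=0$ for each $i$. Then for every natural number $p\le m$ there exist subsets $I_1,\dots,I_n\subseteq\{1,\dots,m\}$, each of cardinality $p$, such that $\|\sum_{i=1}^k\sum_{j\in I_i} a_{i,j}\| \le 4d^2$ for all $k=1,\dots,n$. -/
open Finset

/-- Extreme point step: move to a point with no kernel direction on its fractional support. -/
lemma vertex_step {σ W : Type*} [Fintype σ] [NormedAddCommGroup W] [NormedSpace ℝ W]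
    (L : (σ → ℝ) →ₗ[ℝ] W) (S : Set σ) (x : σ → ℝ) (hx : ∀ s, 0 ≤ x s ∧ x s ≤ 1) :
    ∃ y : σ → ℝ, (∀ s, 0 ≤ y s ∧ y s ≤ 1) ∧ L y = L x ∧ (∀ s, s ∉ S → y s = x s) ∧
      (∀ s, (x s = 0 ∨ x s = 1) → y s = x s) ∧
      ∀ z : σ → ℝ, (∀ s, z s ≠ 0 → s ∈ S ∧ 0 < y s ∧ y s < 1) → L z = 0 → z = 0 := by
  classical
  let C : Set (σ → ℝ) := {y | L y = L x}
  let D : Set (σ → ℝ) := {y | ∀ s, (s ∉ S ∨ x s = 0 ∨ x s = 1) → y s = x s}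
  let K : Set (σ → ℝ) := Set.Icc 0 1 ∩ (C ∩ D)
  have hC : IsClosed C := isClosed_eq L.continuous_of_finiteDimensional continuous_const
  have hD : IsClosed D := by
    have : D = ⋂ s, ⋂ (_ : s ∉ S ∨ x s = 0 ∨ x s = 1), {y : σ → ℝ | y s = x s} := by
      ext y; simp [D]
    rw [this]
    exact isClosed_iInter fun s => isClosed_iInter fun _ =>
      isClosed_eq (continuous_apply s) continuous_const
  have hK : IsCompact K := isCompact_Icc.inter_right (hC.inter hD)
  have hne : K.Nonempty :=
    ⟨x, ⟨fun s => (hx s).1, fun s => (hx s).2⟩, rfl, fun _ _ => rfl⟩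
  obtain ⟨y, hy⟩ := hK.extremePoints_nonempty hne
  obtain ⟨⟨⟨hy0, hy1⟩, hyC, hyD⟩, hext⟩ := mem_extremePoints.1 hy
  refine ⟨y, fun s => ⟨hy0 s, hy1 s⟩, hyC, fun s hs => hyD s (Or.inl hs),
    fun s hs => hyD s (Or.inr hs), ?_⟩
  intro z hz hLz
  -- a small step
  have hev : ∀ s, ∀ᶠ t : ℝ in nhds 0, (0 ≤ y s + t * z s ∧ y s + t * z s ≤ 1) ∧
      (0 ≤ y s - t * z s ∧ y s - t * z s ≤ 1) := by
    intro s
    by_cases h : z s = 0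
    · simpa [h] using ⟨hy0 s, hy1 s⟩
    · obtain ⟨-, h0, h1⟩ := hz s h
      have c1 : Filter.Tendsto (fun t : ℝ => y s + t * z s) (nhds 0) (nhds (y s)) := by
        have : Continuous (fun t : ℝ => y s + t * z s) := by fun_prop
        simpa using this.tendsto 0
      have c2 : Filter.Tendsto (fun t : ℝ => y s - t * z s) (nhds 0) (nhds (y s)) := by
        have : Continuous (fun t : ℝ => y s - t * z s) := by fun_prop
        simpa using this.tendsto 0
      filter_upwards [c1.eventually_const_le h0, c1.eventually_le_const h1,
        c2.eventually_const_le h0, c2.eventually_le_const h1] with t a b c d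
      exact ⟨⟨a, b⟩, c, d⟩
  have hall := Filter.eventually_all.2 hev
  obtain ⟨t, ht, htpos⟩ :=
    ((hall.filter_mono nhdsWithin_le_nhds).and (self_mem_nhdsWithin (s := Set.Ioi (0:ℝ)))).exists
  have htpos : 0 < t := htpos
  have hzD : ∀ s, (s ∉ S ∨ x s = 0 ∨ x s = 1) → z s = 0 := by
    intro s hs
    by_contra h
    obtain ⟨a, b, c⟩ := hz s h
    have := hyD s hs
    rcases hs with hs | hs | hs
    · exact hs a
    · rw [this, hs] at b; exact lt_irrefl _ b
    · rw [this, hs] at c; exact lt_irrefl _ c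
  have k1 : y + t • z ∈ K := by
    refine ⟨⟨fun s => (ht s).1.1, fun s => (ht s).1.2⟩, ?_, ?_⟩
    · change L _ = L x
      rw [map_add, map_smul, hLz, smul_zero, add_zero]; exact hyC
    · intro s hs
      simp [hzD s hs, hyD s hs]
  have k2 : y - t • z ∈ K := by
    refine ⟨⟨fun s => (ht s).2.1, fun s => (ht s).2.2⟩, ?_, ?_⟩
    · change L _ = L x
      rw [map_sub, map_smul, hLz, smul_zero, sub_zero]; exact hyC
    · intro s hs
      simp [hzD s hs, hyD s hs]
  have hseg : y ∈ openSegment ℝ (y + t • z) (y - t • z) := by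
    refine ⟨1/2, 1/2, by norm_num, by norm_num, by norm_num, ?_⟩
    ext s
    simp; ring
  have := hext _ k1 _ k2 hseg
  have h3 : y + t • z = y := this.1
  have h4 : t • z = 0 := by simpa using h3
  exact (smul_eq_zero.1 h4).resolve_left (ne_of_gt htpos)

/-- Counting fractional entries. -/
lemma frac_count {V : Type*} [NormedAddCommGroup V] [NormedSpace ℝ V]
    [FiniteDimensional ℝ V] {n m p : ℕ} (a : Fin n → Fin m → V) (y : Fin n × Fin m → ℝ)
    (hy : ∀ s, 0 ≤ y s ∧ y s ≤ 1) (hrow : ∀ i, ∑ j, y (i, j) = p)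
    (F : Finset (Fin n × Fin m))
    (hF : ∀ i j, (i, j) ∈ F → 0 < y (i, j) ∧ y (i, j) < 1 ∧
      ∀ j', 0 < y (i, j') → y (i, j') < 1 → (i, j') ∈ F)
    (hinj : ∀ z : Fin n × Fin m → ℝ, (∀ s, z s ≠ 0 → s ∈ F) →
      (∑ s, z s • a s.1 s.2 = 0) → (∀ i, ∑ j, z (i, j) = 0) → z = 0) :
    F.card ≤ 2 * Module.finrank ℝ V := by
  classical
  let R : Finset (Fin n) := F.image Prod.fst
  -- each row has at least two
  have h2 : 2 * R.card ≤ F.card := by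
    have hfib : F.card = ∑ i ∈ R, (F.filter fun s => s.1 = i).card :=
      Finset.card_eq_sum_card_fiberwise fun s hs => Finset.mem_image_of_mem _ hs
    rw [hfib, mul_comm, ← smul_eq_mul]
    refine Finset.card_nsmul_le_sum _ _ _ fun i hi => ?_
    obtain ⟨⟨i', j⟩, hs, rfl⟩ := Finset.mem_image.1 hi
    obtain ⟨hj0, hj1, hcl⟩ := hF i' j hs
    have hex : ∃ j', j' ≠ j ∧ 0 < y (i', j') ∧ y (i', j') < 1 := by
      by_contra hno
      push Not at hno
      have hr := hrow i'
      rw [← Finset.add_sum_erase _ _ (Finset.mem_univ j)] at hr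
      have hint : ∑ j' ∈ univ.erase j, y (i', j') =
          (((univ.erase j).filter fun j' => 0 < y (i', j')).card : ℝ) := by
        rw [Finset.card_filter, Nat.cast_sum]
        refine Finset.sum_congr rfl fun j' hj' => ?_
        split_ifs with h
        · simpa using le_antisymm (hy (i', j')).2 (hno j' (Finset.ne_of_mem_erase hj') h)
        · simpa using le_antisymm (not_lt.1 h) (hy (i', j')).1
      rw [hint] at hr
      generalize ((univ.erase j).filter fun j' => 0 < y (i', j')).card = N at hr
      have l1 : (N : ℝ) < p := by linarith
      have l2 : (p : ℝ) < N + 1 := by linarith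
      have l1' : N < p := by exact_mod_cast l1
      have l2' : p < N + 1 := by exact_mod_cast l2
      omega
    obtain ⟨j', hne, h0, h1⟩ := hex
    refine Finset.one_lt_card.2 ⟨(i', j), ?_, (i', j'), ?_, ?_⟩
    · simp [hs]
    · simp [hcl j' h0 h1]
    · simpa using hne.symm
  have h1 : F.card ≤ Module.finrank ℝ V + R.card := by
    let E : (F → ℝ) →ₗ[ℝ] (Fin n × Fin m → ℝ) :=
      { toFun := fun w s => if h : s ∈ F then w ⟨s, h⟩ else 0
        map_add' := by intro u v; ext s; by_cases h : s ∈ F <;> simp [h]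
        map_smul' := by intro u v; ext s; by_cases h : s ∈ F <;> simp [h] }
    let A : (Fin n × Fin m → ℝ) →ₗ[ℝ] V :=
      ∑ s, (LinearMap.proj s : (Fin n × Fin m → ℝ) →ₗ[ℝ] ℝ).smulRight (a s.1 s.2)
    let B : (Fin n × Fin m → ℝ) →ₗ[ℝ] (R → ℝ) :=
      LinearMap.pi fun i => ∑ j, LinearMap.proj ((i : Fin n), j)
    have hi : Function.Injective ((A.prod B).comp E) := by
      rw [← LinearMap.ker_eq_bot, LinearMap.ker_eq_bot']
      intro w hw
      have hA : A (E w) = 0 := congrArg Prod.fst hw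
      have hB : B (E w) = 0 := congrArg Prod.snd hw
      have hE : ∀ s, s ∉ F → E w s = 0 := fun s hs => by simp [E, hs]
      have := hinj (E w) (fun s hs => by by_contra h; exact hs (hE s h))
        (by simpa [A] using hA) (by
          intro i
          by_cases hi : i ∈ R
          · simpa [B] using congrFun hB ⟨i, hi⟩
          · refine Finset.sum_eq_zero fun j _ => hE _ fun h => hi ?_
            exact Finset.mem_image.2 ⟨_, h, rfl⟩)
      ext s
      have h := congrFun this s.1
      simpa [E] using h
    have := LinearMap.finrank_le_finrank_of_injective hi
    simpa using this
  omega

lemma selection_aux {V : Type*} [NormedAddCommGroup V] [NormedSpace ℝ V]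
    [FiniteDimensional ℝ V] {n m p : ℕ} (a : Fin n → Fin m → V)
    (hbd : ∀ i j, ‖a i j‖ ≤ 1) (l : ℕ) : ∀ (k : ℕ), k + l = n →
    ∀ x : Fin n × Fin m → ℝ, (∀ s, 0 ≤ x s ∧ x s ≤ 1) → (∀ i, ∑ j, x (i, j) = p) →
    (∀ i : Fin n, k ≤ i.val → ∑ j, x (i, j) • a i j = 0) →
    (∑ s, x s • a s.1 s.2 = 0) →
    ∃ I : Fin n → Finset (Fin m), (∀ i, (I i).card = p) ∧
      (∀ i j, x (i, j) = 1 → j ∈ I i) ∧ (∀ i j, x (i, j) = 0 → j ∉ I i) ∧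
      ∀ q : Fin n, k ≤ q.val → ‖∑ i ∈ Finset.Iic q, ∑ j ∈ I i, a i j‖ ≤
        2 * (Module.finrank ℝ V : ℝ) := by
  classical
  induction l with
  | zero =>
    intro k hk x hx hrow _ _
    have : ∀ i, ∃ I : Finset (Fin m), univ.filter (fun j => x (i, j) = 1) ⊆ I ∧
        I ⊆ univ.filter (fun j => x (i, j) ≠ 0) ∧ I.card = p := by
      intro i
      apply Finset.exists_subsuperset_card_eq
      · intro j hj
        simp only [Finset.mem_filter, Finset.mem_univ, true_and] at hj ⊢
        rw [hj]; exact one_ne_zero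
      · have : ((univ.filter (fun j => x (i, j) = 1)).card : ℝ) ≤ p := by
          rw [← hrow i, Finset.card_filter, Nat.cast_sum]
          refine Finset.sum_le_sum fun j _ => ?_
          split_ifs with h
          · simp [h]
          · simpa using (hx (i, j)).1
        exact_mod_cast this
      · have : (p : ℝ) ≤ (univ.filter (fun j => x (i, j) ≠ 0)).card := by
          rw [← hrow i, Finset.card_filter, Nat.cast_sum]
          refine Finset.sum_le_sum fun j _ => ?_
          split_ifs with h
          · simpa using (hx (i, j)).2
          · simp only [ne_eq, not_not] at h; simp [h]
        exact_mod_cast this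
    choose I h1 h2 h3 using this
    refine ⟨I, h3, fun i j h => h1 i (by simp [h]), fun i j h hj => ?_, fun q hq => ?_⟩
    · have := h2 i hj
      simp [h] at this
    · have := q.2; omega
  | succ l ih =>
    intro k hk x hx hrow hz htot
    let A : (Fin n × Fin m → ℝ) →ₗ[ℝ] V :=
      ∑ s, (LinearMap.proj s : (Fin n × Fin m → ℝ) →ₗ[ℝ] ℝ).smulRight (a s.1 s.2)
    let B : (Fin n × Fin m → ℝ) →ₗ[ℝ] (Fin n → ℝ) :=
      LinearMap.pi fun i => ∑ j, LinearMap.proj (i, j)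
    have hA : ∀ z, A z = ∑ s, z s • a s.1 s.2 := fun z => by simp [A]
    have hB : ∀ z i, B z i = ∑ j, z (i, j) := fun z i => by simp [B]
    obtain ⟨y, hy, hL, hyS, hyx, hker⟩ := vertex_step (A.prod B) {s | s.1.val ≤ k} x hx
    have hyA : A y = A x := congrArg Prod.fst hL
    have hyB : B y = B x := congrArg Prod.snd hL
    have hyrow : ∀ i, ∑ j, y (i, j) = p := fun i => by rw [← hB, hyB, hB, hrow]
    have hytot : ∑ s, y s • a s.1 s.2 = 0 := by rw [← hA, hyA, hA, htot]
    have hyz : ∀ i : Fin n, k + 1 ≤ i.val → ∑ j, y (i, j) • a i j = 0 := by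
      intro i hi
      rw [← hz i (by omega)]
      refine Finset.sum_congr rfl fun j _ => ?_
      rw [hyS (i, j) (by simp; omega)]
    obtain ⟨I, hc, hI1, hI0, hb⟩ := ih (k + 1) (by omega) y hy hyrow hyz hytot
    refine ⟨I, hc, fun i j h => hI1 i j (by rw [hyx _ (Or.inr h), h]),
      fun i j h => hI0 i j (by rw [hyx _ (Or.inl h), h]), fun q hq => ?_⟩
    rcases Nat.lt_or_ge k q.val with h | h
    · exact hb q h
    have hqk : q.val = k := le_antisymm h hq
    let F : Finset (Fin n × Fin m) :=
      univ.filter fun s => s.1.val ≤ k ∧ 0 < y s ∧ y s < 1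
    have hFc : F.card ≤ 2 * Module.finrank ℝ V := by
      refine frac_count a y hy hyrow F ?_ ?_
      · intro i j hij
        simp only [F, Finset.mem_filter, Finset.mem_univ, true_and] at hij ⊢
        exact ⟨hij.2.1, hij.2.2, fun j' h1 h2 => ⟨hij.1, h1, h2⟩⟩
      · intro z hzF hzA hzB
        refine hker z (fun s hs => by simpa [F] using hzF s hs) ?_
        refine Prod.ext ?_ ?_
        · exact (hA z).trans hzA
        · ext i; exact (hB z i).trans (hzB i)
    let c : Fin n × Fin m → ℝ := fun s => (if s.2 ∈ I s.1 then 1 else 0) - y s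
    have e0 : ∑ i ∈ Finset.Iic q, ∑ j, y (i, j) • a i j = 0 := by
      rw [← hytot, Fintype.sum_prod_type]
      refine Finset.sum_subset (Finset.subset_univ _) fun i _ hi => hyz i ?_
      rw [Finset.mem_Iic, not_le, Fin.lt_def] at hi
      omega
    have e1 : ∑ i ∈ Finset.Iic q, ∑ j ∈ I i, a i j = ∑ s ∈ F, c s • a s.1 s.2 := by
      have : ∑ i ∈ Finset.Iic q, ∑ j ∈ I i, a i j =
          ∑ i ∈ Finset.Iic q, ∑ j, c (i, j) • a i j := by
        simp only [c, sub_smul, Finset.sum_sub_distrib, e0, sub_zero]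
        simp [ite_smul]
      rw [this, ← Finset.sum_product' (Finset.Iic q) univ (fun i j => c (i, j) • a i j)]
      symm
      refine Finset.sum_subset ?_ ?_
      · intro s hs
        simp only [F, Finset.mem_filter, Finset.mem_univ, true_and] at hs
        simp only [Finset.mem_product, Finset.mem_Iic, Finset.mem_univ, and_true, Fin.le_def]
        omega
      · rintro ⟨i, j⟩ hs hsF
        simp only [Finset.mem_product, Finset.mem_Iic, Finset.mem_univ, and_true,
          Fin.le_def] at hs
        simp only [F, Finset.mem_filter, Finset.mem_univ, true_and, not_and, not_lt] at hsF
        have : c (i, j) = 0 := by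
          rcases (hy (i, j)).1.eq_or_lt with h0 | h0
          · simp [c, ← h0, hI0 i j h0.symm]
          · have h1 : y (i, j) = 1 := le_antisymm (hy (i, j)).2 (hsF (by omega) h0)
            simp [c, h1, hI1 i j h1]
        simp [this]
    rw [e1]
    calc ‖∑ s ∈ F, c s • a s.1 s.2‖ ≤ ∑ s ∈ F, (1 : ℝ) := by
          refine norm_sum_le_of_le _ fun s _ => ?_
          have hc1 : |c s| ≤ 1 := by
            have := hy s
            simp only [c]
            rw [abs_le]
            split_ifs <;> constructor <;> linarith
          rw [norm_smul, Real.norm_eq_abs]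
          exact mul_le_one₀ hc1 (norm_nonneg _) (hbd _ _)
      _ = F.card := by simp
      _ ≤ _ := by exact_mod_cast hFc

theorem subset_selection_lemma (V : Type*) [NormedAddCommGroup V] [NormedSpace ℝ V]
    [FiniteDimensional ℝ V]
    (n m p : ℕ) (hp : p ≤ m)
    (a : Fin n → Fin m → V)
    (hbd : ∀ i j, ‖a i j‖ ≤ 1)
    (hsum : ∀ i, ∑ j, a i j = 0) :
    ∃ I : Fin n → Finset (Fin m),
      (∀ i, (I i).card = p) ∧
      ∀ k : Fin n, ‖∑ i ∈ Finset.Iic k, ∑ j ∈ I i, a i j‖ ≤ 4 * (Module.finrank ℝ V : ℝ) ^ 2 := by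
  have hpm : (p : ℝ) ≤ m := by exact_mod_cast hp
  have hrows : ∀ i : Fin n, ∑ j, ((p : ℝ) / m) • a i j = 0 := fun i => by
    rw [← Finset.smul_sum, hsum, smul_zero]
  obtain ⟨I, hc, -, -, hb⟩ := selection_aux (p := p) a hbd n 0 (by omega)
    (fun _ => (p : ℝ) / m)
    (fun _ => ⟨by positivity, div_le_one_of_le₀ hpm (by positivity)⟩)
    (fun i => by
      rcases Nat.eq_zero_or_pos m with h | h
      · subst h
        obtain rfl : p = 0 := by omega
        simp
      · have : (m : ℝ) ≠ 0 := by positivity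
        simp; field_simp)
    (fun i _ => hrows i)
    (by
      rw [Fintype.sum_prod_type]
      exact Finset.sum_eq_zero fun i _ => hrows i)
  refine ⟨I, hc, fun k => (hb k (Nat.zero_le _)).trans ?_⟩
  rcases Nat.eq_zero_or_pos (Module.finrank ℝ V) with h | h
  · simp [h]
  · have : (1 : ℝ) ≤ Module.finrank ℝ V := by exact_mod_cast h
    nlinarith
end

section
/- Let $V$ be a finite-dimensional real normed space, $D\subseteq[0,1]$ of positive measure, and $f\in L_1(D;V)$ mean zero. For every $\varepsilon>0$ there exists $\delta>0$ such that for every measurable $D'\subseteq D$ with $\lambda(D\setminus D')<\delta$ and every $u\in\mathrm{Span}(\sigma(f))$ with $\|u\|\le\delta$, there is a compact set $E\subseteq D'$ with $\lambda(D\setminus E)<\varepsilon$, $\int_E(f+u)\,d\lambda=0$, and $f|_E$ continuous. -/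
open MeasureTheory

/-- The essential range of `f` with respect to the measure `μ`. -/
def essRange {V : Type*} [TopologicalSpace V] (μ : Measure ℝ) (f : ℝ → V) : Set V :=
  {r | ∀ U ∈ nhds r, 0 < μ (f ⁻¹' U)}

open scoped NNReal ENNReal

theorem aux_lusin {V : Type*} [NormedAddCommGroup V] [NormedSpace ℝ V]
    [FiniteDimensional ℝ V] [MeasurableSpace V] [BorelSpace V] (f : ℝ → V) (hf : Measurable f)
    (A : Set ℝ) (hA : MeasurableSet A) (hA' : volume A ≠ ∞) (δ : ℝ≥0∞) (hδ : 0 < δ) :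
    ∃ K, IsCompact K ∧ K ⊆ A ∧ volume (A \ K) < δ ∧ ContinuousOn f K := by
  have : SecondCountableTopology V := secondCountable_of_proper
  let b := TopologicalSpace.countableBasis V
  have hb := TopologicalSpace.isBasis_countableBasis V
  have : Countable b := TopologicalSpace.countable_countableBasis V
  obtain ⟨e, he, hes⟩ := ENNReal.exists_pos_sum_of_countable' (ENNReal.half_pos hδ.ne').ne' b
  have h1 : ∀ U : b, ∃ K, K ⊆ A ∩ f ⁻¹' U ∧ IsCompact K ∧ volume ((A ∩ f ⁻¹' U) \ K) < e U := by
    intro U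
    refine (hA.inter (hf (hb.isOpen U.2).measurableSet)).exists_isCompact_sdiff_lt ?_ (he U).ne'
    exact ((measure_mono Set.inter_subset_left).trans_lt hA'.lt_top).ne
  have h2 : ∀ U : b, ∃ K, K ⊆ A \ f ⁻¹' U ∧ IsCompact K ∧ volume ((A \ f ⁻¹' U) \ K) < e U := by
    intro U
    refine (hA.diff (hf (hb.isOpen U.2).measurableSet)).exists_isCompact_sdiff_lt ?_ (he U).ne'
    exact ((measure_mono Set.sdiff_subset).trans_lt hA'.lt_top).ne
  choose K hK1 hK2 hK3 using h1
  choose L hL1 hL2 hL3 using h2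
  have hbne : Nonempty b := by
    obtain ⟨U, hU, _⟩ := hb.exists_subset_of_mem_open (Set.mem_univ (0 : V)) isOpen_univ
    exact ⟨⟨U, hU⟩⟩
  refine ⟨⋂ U, (K U ∪ L U), ?_, ?_, ?_, ?_⟩
  · obtain ⟨U⟩ := hbne
    refine ((hK2 U).union (hL2 U)).of_isClosed_subset ?_ (Set.iInter_subset _ U)
    exact isClosed_iInter fun U => ((hK2 U).union (hL2 U)).isClosed
  · obtain ⟨U⟩ := hbne
    refine (Set.iInter_subset _ U).trans (Set.union_subset ?_ ?_)
    · exact (hK1 U).trans Set.inter_subset_left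
    · exact (hL1 U).trans Set.sdiff_subset
  · have hsub : A \ ⋂ U, (K U ∪ L U) ⊆
        (⋃ U : b, (A ∩ f ⁻¹' U) \ K U) ∪ (⋃ U : b, (A \ f ⁻¹' U) \ L U) := by
      rintro x ⟨hx, hx'⟩
      simp only [Set.mem_iInter, not_forall] at hx'
      obtain ⟨U, hU⟩ := hx'
      rw [Set.mem_union, not_or] at hU
      by_cases h : x ∈ f ⁻¹' (U : Set V)
      · exact Or.inl (Set.mem_iUnion.2 ⟨U, ⟨hx, h⟩, hU.1⟩)
      · exact Or.inr (Set.mem_iUnion.2 ⟨U, ⟨hx, h⟩, hU.2⟩)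
    calc volume (A \ ⋂ U, (K U ∪ L U)) ≤ _ := measure_mono hsub
      _ ≤ _ := measure_union_le _ _
      _ ≤ (∑' U, e U) + ∑' U, e U := by
        gcongr
        · exact (measure_iUnion_le _).trans (ENNReal.tsum_le_tsum fun U => (hK3 U).le)
        · exact (measure_iUnion_le _).trans (ENNReal.tsum_le_tsum fun U => (hL3 U).le)
      _ < δ / 2 + δ / 2 := ENNReal.add_lt_add hes hes
      _ = δ := ENNReal.add_halves δ
  · rw [continuousOn_iff_continuous_domRestrict, hb.continuous_iff]
    intro U hU
    have : (Set.domRestrict (⋂ U, (K U ∪ L U)) f) ⁻¹' U = Subtype.val ⁻¹' (L ⟨U, hU⟩)ᶜ := by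
      ext ⟨x, hx⟩
      have hx' := Set.mem_iInter.1 hx ⟨U, hU⟩
      simp only [Set.mem_preimage, Set.domRestrict_apply, Set.mem_compl_iff]
      constructor
      · intro h h'
        exact (hL1 _ h').2 h
      · intro h
        exact (hK1 _ (hx'.resolve_right h)).2
    rw [this]
    exact (hL2 _).isClosed.isOpen_compl.preimage continuous_subtype_val

theorem aux_essRange {V : Type*} [NormedAddCommGroup V] [NormedSpace ℝ V]
    [FiniteDimensional ℝ V] [MeasurableSpace V] [BorelSpace V] (μ : Measure ℝ)
    (f : ℝ → V) (hf : Measurable f) : ∀ᵐ x ∂μ, f x ∈ essRange μ f := by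
  have : SecondCountableTopology V := secondCountable_of_proper
  have h : ∀ᵐ y ∂(μ.map f), y ∈ (μ.map f).support := Measure.support_mem_ae
  filter_upwards [ae_of_ae_map hf.aemeasurable h] with x hx
  intro U hU
  rw [Measure.mem_support_iff_forall] at hx
  obtain ⟨O, hO, hO1, hO2⟩ := mem_nhds_iff.1 hU
  have := hx O (hO1.mem_nhds hO2)
  rw [Measure.map_apply hf hO1.measurableSet] at this
  exact this.trans_le (measure_mono (Set.preimage_mono hO))

theorem aux_cone {V : Type*} [NormedAddCommGroup V] [NormedSpace ℝ V]
    [FiniteDimensional ℝ V] [MeasurableSpace V] [BorelSpace V] (μ : Measure ℝ)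
    (f : ℝ → V) (hf : Measurable f) (hfi : Integrable f μ) (h0 : ∫ x, f x ∂μ = 0) :
    ∃ (T : Finset V) (c : V → ℝ), (T : Set V) ⊆ essRange μ f ∧ (∀ p ∈ T, 0 < c p) ∧
      ∑ p ∈ T, c p • p = 0 ∧
      Submodule.span ℝ (T : Set V) = Submodule.span ℝ (essRange μ f) := by
  classical
  set S := essRange μ f with hS
  obtain ⟨b, hbS, hbspan, hbli⟩ := exists_linearIndependent ℝ S
  have hbfin : b.Finite := hbli.setFinite
  set B := hbfin.toFinset with hB
  set C : ProperCone ℝ V := Submodule.closure (PointedCone.hull ℝ S) with hC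
  have hmem : -∑ p ∈ B, p ∈ C := by
    by_contra hn
    obtain ⟨φ, hφ, hφ'⟩ := C.hyperplane_separation_point hn
    have hpos : ∀ p ∈ S, 0 ≤ φ p := fun p hp => hφ p (subset_closure (Submodule.subset_span hp))
    have hae : ∀ᵐ x ∂μ, f x ∈ S := aux_essRange μ f hf
    have hint : ∫ x, φ (f x) ∂μ = 0 := by
      rw [φ.integral_comp_comm hfi, h0, map_zero]
    have hz : (fun x => φ (f x)) =ᵐ[μ] 0 := by
      refine (integral_eq_zero_iff_of_nonneg_ae ?_ (φ.integrable_comp hfi)).1 hint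
      filter_upwards [hae] with x hx using hpos _ hx
    have hzero : ∀ p ∈ S, φ p = 0 := by
      intro p hp
      by_contra hne
      have ho : {y | φ y ≠ 0} ∈ nhds p := (isOpen_ne_fun φ.continuous continuous_const).mem_nhds hne
      have h1 := hp _ ho
      exact h1.ne' hz
    rw [map_neg, map_sum, Finset.sum_eq_zero] at hφ'
    · simp at hφ'
    · intro p hp
      exact hzero p (hbS (by simpa [hB] using hp))
  let bb := Module.Basis.span hbli
  have : Fintype b := hbfin.fintype
  let co := bb.equivFunL
  have hopen : {w | ∀ j, co w j < 1} ∈ nhds (0 : Submodule.span ℝ (Set.range ((↑) : b → V))) := by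
    have : {w | ∀ j, co w j < 1} = ⋂ j, {w | co w j < 1} := by ext; simp
    rw [this]
    refine IsOpen.mem_nhds (isOpen_iInter_of_finite fun j => ?_) (by simp)
    exact isOpen_lt ((continuous_apply j).comp co.continuous) continuous_const
  obtain ⟨θ, hθ, hθ'⟩ := Metric.mem_nhds_iff.1 hopen
  obtain ⟨y, hy, hyd⟩ := Metric.mem_closure_iff.1 hmem θ hθ
  obtain ⟨c, hcS, hcy⟩ := Submodule.mem_span_set.1 hy
  have hrange : Submodule.span ℝ (Set.range ((↑) : b → V)) = Submodule.span ℝ S := by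
    rw [Subtype.range_coe, hbspan]
  have hyW : y ∈ Submodule.span ℝ S := by
    rw [← hcy]
    refine Submodule.sum_mem _ fun p hp => ?_
    exact Submodule.smul_mem _ (c p : ℝ) (Submodule.subset_span (hcS hp))
  have hBS : ∀ p ∈ B, p ∈ S := fun p hp => hbS (by simpa [hB] using hp)
  have heW : y + ∑ p ∈ B, p ∈ Submodule.span ℝ (Set.range ((↑) : b → V)) := by
    rw [hrange]
    exact Submodule.add_mem _ hyW (Submodule.sum_mem _ fun p hp => Submodule.subset_span (hBS p hp))
  let w : Submodule.span ℝ (Set.range ((↑) : b → V)) := ⟨_, heW⟩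
  have hw : ∀ j, co w j < 1 := by
    apply hθ' 
    rw [mem_ball_zero_iff]
    change ‖y + ∑ p ∈ B, p‖ < θ
    have h : y + ∑ p ∈ B, p = -(-∑ p ∈ B, p - y) := by abel
    rw [h, norm_neg, ← dist_eq_norm]
    exact hyd
  have hwsum : ∑ j : b, co w j • (j : V) = y + ∑ p ∈ B, p := by
    have h := congrArg Subtype.val (bb.sum_equivFun w)
    rw [AddSubmonoidClass.coe_finsetSum] at h
    refine Eq.trans (Finset.sum_congr rfl fun j _ => ?_) h
    simp [co, bb, Module.Basis.span_apply]
  let d : V → ℝ := fun p => if h : p ∈ b then 1 - co w ⟨p, h⟩ else 0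
  have hd0 : ∀ p, 0 ≤ d p := by
    intro p
    by_cases h : p ∈ b
    · have := hw ⟨p, h⟩
      simp only [d, h, dif_pos]; linarith
    · simp [d, h]
  have hdB : ∀ p ∈ B, 0 < d p := by
    intro p hp
    have h : p ∈ b := by simpa [hB] using hp
    have := hw ⟨p, h⟩
    simp only [d, h, dif_pos]; linarith
  have hdsum : ∑ p ∈ B, d p • p = - y := by
    have h1 : ∑ p ∈ B, d p • p = ∑ j : b, d j • (j : V) := by
      refine Finset.sum_subtype (p := fun x => x ∈ b) B (fun x => by simp [hB]) (fun p => d p • p)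
    have h2 : ∑ p ∈ B, p = ∑ j : b, (j : V) := 
      Finset.sum_subtype (p := fun x => x ∈ b) B (fun x => by simp [hB]) (fun p => p)
    have h3 : ∑ j : b, d j • (j : V) = ∑ j : b, ((j : V) - co w j • (j : V)) := by
      refine Finset.sum_congr rfl fun j _ => ?_
      simp [d, sub_smul]
    rw [h1, h3, Finset.sum_sub_distrib, hwsum, h2]
    abel
  refine ⟨B ∪ c.support, fun p => c p + d p, ?_, ?_, ?_, ?_⟩
  · intro p hp
    rcases Finset.mem_union.1 (Finset.mem_coe.1 hp) with h | h
    · exact hBS p h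
    · exact hcS h
  · intro p hp
    rcases Finset.mem_union.1 hp with h | h
    · have := hdB p h
      have h2 : (0 : ℝ) ≤ c p := (c p).2
      linarith
    · have := hd0 p
      have h2 : (0 : ℝ) < c p := lt_of_le_of_ne (c p).2 (fun h' => (Finsupp.mem_support_iff.1 h) (Subtype.ext h'.symm))
      linarith
  · simp only [add_smul, Finset.sum_add_distrib]
    have h1 : ∑ p ∈ B ∪ c.support, (c p : ℝ) • p = y := by
      rw [← hcy]
      symm
      refine Finset.sum_subset Finset.subset_union_right fun p _ hp => ?_
      rw [Finsupp.notMem_support_iff.1 hp]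
      exact zero_smul _ p
    have h2 : ∑ p ∈ B ∪ c.support, d p • p = -y := by
      rw [← hdsum]
      symm
      refine Finset.sum_subset Finset.subset_union_left fun p _ hp => ?_
      have : p ∉ b := by simpa [hB] using hp
      simp [d, this]
    rw [h1, h2]
    abel
  · apply le_antisymm
    · apply Submodule.span_mono
      intro p hp
      rcases Finset.mem_union.1 (Finset.mem_coe.1 hp) with h | h
      · exact hBS p h
      · exact hcS h
    · rw [← hbspan]
      apply Submodule.span_mono
      intro p hp
      simp [hB, hp]

theorem aux_ivt (A : Set ℝ) (hA1 : A ⊆ Set.Icc 0 1) :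
    ∃ x : ℝ → ℝ, ∀ s, 0 ≤ s → s ≤ volume.real A → volume.real (A ∩ Set.Iio (x s)) = s := by
  have hfin : ∀ B ⊆ A, volume B ≠ ∞ := fun B hB =>
    ((measure_mono (hB.trans hA1)).trans_lt (by simp)).ne
  have hlip : LipschitzWith 1 (fun x => volume.real (A ∩ Set.Iio x)) := by
    apply LipschitzWith.of_le_add
    intro x y
    have : A ∩ Set.Iio x ⊆ (A ∩ Set.Iio y) ∪ Set.Ico y x := by
      intro z hz
      by_cases h : z < y
      · exact Or.inl ⟨hz.1, h⟩
      · exact Or.inr ⟨not_lt.1 h, hz.2⟩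
    have h1 : volume.real (A ∩ Set.Iio x) ≤ volume.real ((A ∩ Set.Iio y) ∪ Set.Ico y x) :=
      measureReal_mono this ((measure_union_lt_top (hfin _ Set.inter_subset_left).lt_top (by simp)).ne)
    have h2 := measureReal_union_le (μ := volume) (A ∩ Set.Iio y) (Set.Ico y x)
    have h3 : volume.real (Set.Ico y x) ≤ dist x y := by
      rw [Real.volume_real_Ico, Real.dist_eq]
      exact max_le (le_abs_self _) (abs_nonneg _)
    linarith
  have h : ∀ s : ℝ, ∃ x, 0 ≤ s → s ≤ volume.real A → volume.real (A ∩ Set.Iio x) = s := by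
    intro s
    by_cases hs : 0 ≤ s ∧ s ≤ volume.real A
    · have h0 : A ∩ Set.Iio 0 = ∅ := by
        ext z; simp only [Set.mem_inter_iff, Set.mem_Iio, Set.mem_empty_iff_false, iff_false]
        rintro ⟨h, h'⟩
        exact absurd (hA1 h).1 (not_le.2 h')
      have h2 : A ∩ Set.Iio 2 = A := by
        refine Set.inter_eq_left.2 fun z hz => ?_
        have := (hA1 hz).2
        simp only [Set.mem_Iio]; linarith
      have := intermediate_value_Icc (show (0:ℝ) ≤ 2 by norm_num) hlip.continuous.continuousOn
      obtain ⟨x, _, hx⟩ := this (show s ∈ _ by simp only [h0, h2, measureReal_empty]; exact hs)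
      exact ⟨x, fun _ _ => hx⟩
    · exact ⟨0, fun h1 h2 => absurd ⟨h1, h2⟩ hs⟩
  choose x hx using h
  exact ⟨x, hx⟩

theorem aux_curve {V : Type*} [NormedAddCommGroup V] [NormedSpace ℝ V]
    [FiniteDimensional ℝ V] (A : Set ℝ) (hA : MeasurableSet A) (hA1 : A ⊆ Set.Icc 0 1)
    (g : ℝ → V) (hg : IntegrableOn g A) (p : V) (κ : ℝ) (hκ : ∀ x ∈ A, ‖g x - p‖ ≤ κ) :
    ∃ x : ℝ → ℝ, (∀ s, 0 ≤ s → s ≤ volume.real A → volume.real (A ∩ Set.Iio (x s)) = s) ∧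
      ∀ s t, 0 ≤ s → s ≤ volume.real A → 0 ≤ t → t ≤ volume.real A →
        ‖(∫ y in A ∩ Set.Iio (x s), g y) - (∫ y in A ∩ Set.Iio (x t), g y) - (s - t) • p‖
          ≤ κ * |s - t| := by
  obtain ⟨x, hx⟩ := aux_ivt A hA1
  refine ⟨x, hx, ?_⟩
  have hfin : ∀ B ⊆ A, volume B < ∞ := fun B hB =>
    ((measure_mono (hB.trans hA1)).trans_lt (by simp))
  have key : ∀ s t, 0 ≤ t → t < s → s ≤ volume.real A →
        ‖(∫ y in A ∩ Set.Iio (x s), g y) - (∫ y in A ∩ Set.Iio (x t), g y) - (s - t) • p‖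
          ≤ κ * |s - t| := by
    intro s t ht hts hs
    have hxs := hx s (ht.trans hts.le) hs
    have hxt := hx t ht (hts.le.trans hs)
    have hlt : x t ≤ x s := by
      by_contra hn
      have : volume.real (A ∩ Set.Iio (x s)) ≤ volume.real (A ∩ Set.Iio (x t)) :=
        measureReal_mono (Set.inter_subset_inter_right _ (Set.Iio_subset_Iio (not_le.1 hn).le))
          (hfin _ Set.inter_subset_left).ne
      linarith
    have hsub : A ∩ Set.Iio (x t) ⊆ A ∩ Set.Iio (x s) :=
      Set.inter_subset_inter_right _ (Set.Iio_subset_Iio hlt)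
    set Q := (A ∩ Set.Iio (x s)) \ (A ∩ Set.Iio (x t)) with hQ
    have hQA : Q ⊆ A := Set.sdiff_subset.trans Set.inter_subset_left
    have hmt : MeasurableSet (A ∩ Set.Iio (x t)) := hA.inter measurableSet_Iio
    have hms : MeasurableSet (A ∩ Set.Iio (x s)) := hA.inter measurableSet_Iio
    have hQm : volume.real Q = s - t := by
      rw [hQ, measureReal_sdiff hsub hmt (hfin _ Set.inter_subset_left).ne, hxs, hxt]
    have h1 : (∫ y in A ∩ Set.Iio (x s), g y) - (∫ y in A ∩ Set.Iio (x t), g y) = (∫ y in Q, g y) := by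
      rw [hQ, setIntegral_sdiff hmt (hg.mono_set Set.inter_subset_left) hsub]
    have h2 : (s - t) • p = (∫ y in Q, p) := by
      rw [setIntegral_const, hQm]
    rw [h1, h2, ← integral_sub (hg.mono_set hQA) (integrableOn_const (hfin Q hQA).ne)]
    refine (norm_setIntegral_le_of_norm_le_const (hfin Q hQA) (C := κ) ?_).trans ?_
    · exact fun y hy => hκ y (hQA hy)
    · rw [hQm, abs_of_pos (sub_pos.2 hts)]
  intro s t hs hs' ht ht'
  rcases lt_trichotomy s t with h | h | h
  · have := key t s hs h ht'
    rw [abs_sub_comm, ← norm_neg]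
    have h2 : -((∫ y in A ∩ Set.Iio (x s), g y) - (∫ y in A ∩ Set.Iio (x t), g y) - (s - t) • p) =
        (∫ y in A ∩ Set.Iio (x t), g y) - (∫ y in A ∩ Set.Iio (x s), g y) - (t - s) • p := by
      rw [← neg_sub s t, neg_smul]
      abel
    rw [h2]
    exact this
  · subst h
    simp
  · exact key s t ht h hs'

theorem aux_pos {α : Type*} (s : Finset α) (g : α → ℝ) (h : ∀ a ∈ s, 0 < g a) :
    ∃ m, 0 < m ∧ ∀ a ∈ s, m ≤ g a := by
  classical
  induction s using Finset.induction_on with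
  | empty => exact ⟨1, one_pos, by simp⟩
  | insert a s ha ih =>
    obtain ⟨m, hm, hm'⟩ := ih fun b hb => h b (Finset.mem_insert_of_mem hb)
    refine ⟨min m (g a), lt_min hm (h a (Finset.mem_insert_self _ _)), fun b hb => ?_⟩
    rcases Finset.mem_insert.1 hb with rfl | hb
    · exact min_le_right _ _
    · exact (min_le_left _ _).trans (hm' b hb)

theorem aux_abscont {V : Type*} [NormedAddCommGroup V] [NormedSpace ℝ V]
    (D : Set ℝ) (hD : MeasurableSet D) (f : ℝ → V) (hf : Integrable f (volume.restrict D))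
    (r : ℝ) (hr : 0 < r) :
    ∃ δ : ℝ, 0 < δ ∧ ∀ s, MeasurableSet s → s ⊆ D → volume s < ENNReal.ofReal δ →
      ‖∫ x in s, f x‖ < r := by
  obtain ⟨δ, hδ, h⟩ := exists_pos_setLIntegral_lt_of_measure_lt (μ := volume.restrict D)
    (f := fun x => ‖f x‖ₑ) hf.2.ne (ε := ENNReal.ofReal r) (by simpa using hr)
  obtain ⟨δ', hδ', hlt⟩ : ∃ δ' : ℝ, 0 < δ' ∧ ENNReal.ofReal δ' ≤ δ := by
    by_cases hT : δ = ∞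
    · exact ⟨1, one_pos, by simp [hT]⟩
    · exact ⟨δ.toReal, ENNReal.toReal_pos hδ.ne' hT, by rw [ENNReal.ofReal_toReal hT]⟩
  refine ⟨δ', hδ', fun s hs hsD hsv => ?_⟩
  have h1 := h s (by rw [Measure.restrict_apply hs, Set.inter_eq_left.2 hsD]; exact hsv.trans_le hlt)
  rw [Measure.restrict_restrict hs, Set.inter_eq_left.2 hsD] at h1
  have h2 := enorm_integral_le_lintegral_enorm (μ := volume.restrict s) f
  have h3 := h2.trans_lt h1
  rwa [← ofReal_norm, ENNReal.ofReal_lt_ofReal_iff hr] at h3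

theorem aux_core {V : Type*} [NormedAddCommGroup V] [NormedSpace ℝ V]
    [FiniteDimensional ℝ V] [MeasurableSpace V] [BorelSpace V]
    (D : Set ℝ) (hD : MeasurableSet D) (hD1 : D ⊆ Set.Icc 0 1)
    (f : ℝ → V) (hfm : Measurable f) (hf : Integrable f (volume.restrict D))
    (hmean : ∫ x in D, f x = 0)
    (ε : ℝ) (hε : 0 < ε) :
    ∃ δ : ℝ, 0 < δ ∧
      ∀ D' : Set ℝ, MeasurableSet D' → D' ⊆ D →
        volume (D \ D') < ENNReal.ofReal δ →
        ∀ u ∈ Submodule.span ℝ (essRange (volume.restrict D) f), ‖u‖ ≤ δ →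
          ∃ E : Set ℝ, IsCompact E ∧ E ⊆ D' ∧
            volume (D \ E) < ENNReal.ofReal ε ∧
            (∫ x in E, (f x + u)) = 0 ∧
            ContinuousOn f E := by
  classical
  have hDfin : ∀ B ⊆ D, volume B < ∞ := fun B hB =>
    ((measure_mono (hB.trans hD1)).trans_lt (by simp))
  obtain ⟨T, c, hTS, hc, hcsum, hspan⟩ := aux_cone (volume.restrict D) f hfm hf hmean
  set W := Submodule.span ℝ (essRange (volume.restrict D) f) with hW
  have hfW : ∀ᵐ x ∂(volume.restrict D), f x ∈ W := by
    filter_upwards [aux_essRange (volume.restrict D) f hfm] with x hx using Submodule.subset_span hx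
  obtain ⟨P, hP⟩ := Submodule.ClosedComplemented.of_finiteDimensional W
  have hTW : ∀ p ∈ T, p ∈ W := fun p hp => Submodule.subset_span (hTS hp)
  let L0 : (T → ℝ) →ₗ[ℝ] W :=
    ∑ p : T, (LinearMap.proj p : (T → ℝ) →ₗ[ℝ] ℝ).smulRight ⟨p, hTW p p.2⟩
  let L : (T → ℝ) →L[ℝ] W := L0.toContinuousLinearMap
  have hL : ∀ s, (L s : V) = ∑ p : T, s p • (p : V) := by
    intro s
    simp [L, L0, LinearMap.sum_apply]
  have hLsurj : L.range = ⊤ := by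
    rw [LinearMap.range_eq_top]
    rintro ⟨w, hw⟩
    rw [← hspan, Submodule.mem_span_finset] at hw
    obtain ⟨a, -, ha⟩ := hw
    refine ⟨fun p => a p, Subtype.ext ?_⟩
    refine (hL _).trans ?_
    refine Eq.trans ?_ ha
    exact Finset.sum_coe_sort T (fun p => a p • p)
  obtain ⟨N, hN⟩ := L.exists_nonlinearRightInverse_of_surjective hLsurj
  set I : ℝ := (N.nnnorm : ℝ)⁻¹ with hI
  have hIpos : 0 < I := inv_pos.2 (by exact_mod_cast hN)
  obtain ⟨c0, hc0, hc0'⟩ := aux_pos T c hc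
  obtain ⟨C, hC, hC'⟩ : ∃ C, 0 < C ∧ ∀ p ∈ T, c p ≤ C := by
    refine ⟨∑ p ∈ T, c p + 1, ?_, fun p hp => ?_⟩
    · have := Finset.sum_nonneg fun p hp => (hc p hp).le
      linarith
    · have := Finset.single_le_sum (fun p hp => (hc p hp).le) hp
      linarith
  obtain ⟨η2, hη2, hη2'⟩ := aux_pos T.offDiag (fun q => dist q.1 q.2) (by
    intro q hq
    exact dist_pos.2 (Finset.mem_offDiag.1 hq).2.2)
  set n : ℝ := (T.card : ℝ) with hn
  have hn0 : 0 ≤ n := by positivity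
  obtain ⟨κ, hκ, hκ1, hκ2⟩ : ∃ κ : ℝ, 0 < κ ∧ κ ≤ I / 2 ∧ κ * C ≤ I * c0 / 4 := by
    refine ⟨min (I / 2) (I * c0 / 4 / C), by positivity, min_le_left _ _, ?_⟩
    rw [← le_div_iff₀ hC]
    exact min_le_right _ _
  obtain ⟨η, hη, hη1, hη3⟩ : ∃ η : ℝ, 0 < η ∧ ‖P‖ * (n * (2 * η)) ≤ κ ∧ 2 * η ≤ η2 := by
    refine ⟨min (κ / (2 * (‖P‖ * n + 1))) (η2 / 2), by positivity, ?_, ?_⟩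
    · have h1 := min_le_left (κ / (2 * (‖P‖ * n + 1))) (η2 / 2)
      rw [le_div_iff₀ (by positivity)] at h1
      have : 0 < min (κ / (2 * (‖P‖ * n + 1))) (η2 / 2) := by positivity
      nlinarith
    · have := min_le_right (κ / (2 * (‖P‖ * n + 1))) (η2 / 2)
      linarith
  obtain ⟨m0, hm0, hm0'⟩ := aux_pos T (fun p => volume.real (D ∩ f ⁻¹' Metric.ball p η)) (by
    intro p hp
    have h := hTS hp _ (Metric.ball_mem_nhds p hη)
    rw [Measure.restrict_apply (hfm measurableSet_ball), Set.inter_comm] at h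
    exact ENNReal.toReal_pos h.ne' (hDfin _ Set.inter_subset_left).ne)
  obtain ⟨τ, hτ, hτ1, hτ2⟩ : ∃ τ : ℝ, 0 < τ ∧ 2 * (τ * C) ≤ m0 / 2 ∧ n * (2 * (τ * C)) ≤ ε / 2 := by
    refine ⟨min (m0 / (4 * C)) (ε / (4 * (n + 1) * C)), by positivity, ?_, ?_⟩
    · have h1 := min_le_left (m0 / (4 * C)) (ε / (4 * (n + 1) * C))
      rw [le_div_iff₀ (by positivity)] at h1
      linarith
    · have h1 := min_le_right (m0 / (4 * C)) (ε / (4 * (n + 1) * C))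
      rw [le_div_iff₀ (by positivity)] at h1
      have : 0 < min (m0 / (4 * C)) (ε / (4 * (n + 1) * C)) * C := by positivity
      nlinarith
  obtain ⟨R, hR, hR1⟩ : ∃ R : ℝ, 0 < R ∧ ‖P‖ * (R + R) ≤ I * (τ * c0) / 4 := by
    refine ⟨I * (τ * c0) / 4 / (2 * (‖P‖ + 1)), by positivity, ?_⟩
    have h1 := (le_div_iff₀ (by positivity)).1 (le_refl (I * (τ * c0) / 4 / (2 * (‖P‖ + 1))))
    have : 0 < I * (τ * c0) / 4 / (2 * (‖P‖ + 1)) := by positivity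
    nlinarith
  obtain ⟨δ1, hδ1, hδ1'⟩ := aux_abscont D hD f hf R hR
  obtain ⟨δ, hδ, d1, d2, d3, d4, d5⟩ : ∃ δ : ℝ, 0 < δ ∧ δ ≤ η ∧ δ ≤ R ∧ δ + δ ≤ δ1 ∧
      δ + δ ≤ m0 / 2 ∧ δ + δ ≤ ε / 2 := by
    refine ⟨min η (min R (min (δ1 / 2) (min (m0 / 4) (ε / 4)))), by positivity, ?_, ?_, ?_, ?_, ?_⟩
    all_goals
      have a1 := min_le_left η (min R (min (δ1 / 2) (min (m0 / 4) (ε / 4))))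
      have a2 := min_le_right η (min R (min (δ1 / 2) (min (m0 / 4) (ε / 4))))
      have a3 := min_le_left R (min (δ1 / 2) (min (m0 / 4) (ε / 4)))
      have a4 := min_le_right R (min (δ1 / 2) (min (m0 / 4) (ε / 4)))
      have a5 := min_le_left (δ1 / 2) (min (m0 / 4) (ε / 4))
      have a6 := min_le_right (δ1 / 2) (min (m0 / 4) (ε / 4))
      have a7 := min_le_left (m0 / 4) (ε / 4)
      have a8 := min_le_right (m0 / 4) (ε / 4)
      linarith
  refine ⟨δ, hδ, fun D' hD' hD'D hvol u hu hud => ?_⟩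
  obtain ⟨K, hK, hKD', hKvol, hKf⟩ := aux_lusin f hfm D' hD' (hDfin D' hD'D).ne
    (ENNReal.ofReal δ) (by simpa using hδ)
  have hKD : K ⊆ D := hKD'.trans hD'D
  have hKm : MeasurableSet K := hK.measurableSet
  have hDK : volume (D \ K) < ENNReal.ofReal (δ + δ) := by
    have : D \ K ⊆ (D \ D') ∪ (D' \ K) := by
      intro x hx
      by_cases h : x ∈ D'
      · exact Or.inr ⟨h, hx.2⟩
      · exact Or.inl ⟨hx.1, h⟩
    rw [ENNReal.ofReal_add hδ.le hδ.le]
    exact (measure_mono this).trans_lt ((measure_union_le _ _).trans_lt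
      (ENNReal.add_lt_add hvol hKvol))
  have hDKr : volume.real (D \ K) < δ + δ :=
    (ENNReal.lt_ofReal_iff_toReal_lt (hDfin _ Set.sdiff_subset).ne).1 hDK
  let A : V → Set ℝ := fun p => K ∩ f ⁻¹' Metric.ball p η
  have hAm : ∀ p, MeasurableSet (A p) := fun p => hKm.inter (hfm measurableSet_ball)
  have hAK : ∀ p, A p ⊆ K := fun p => Set.inter_subset_left
  have hAvol : ∀ p ∈ T, m0 / 2 ≤ volume.real (A p) := by
    intro p hp
    have h1 := hm0' p hp
    have h2 : D ∩ f ⁻¹' Metric.ball p η ⊆ A p ∪ (D \ K) := by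
      intro x hx
      by_cases h : x ∈ K
      · exact Or.inl ⟨h, hx.2⟩
      · exact Or.inr ⟨hx.1, h⟩
    have h3 : volume.real (D ∩ f ⁻¹' Metric.ball p η) ≤ volume.real (A p ∪ (D \ K)) :=
      measureReal_mono h2 (hDfin _ (Set.union_subset ((hAK p).trans hKD) Set.sdiff_subset)).ne
    have h4 := measureReal_union_le (μ := volume) (A p) (D \ K)
    linarith
  let g : ℝ → V := fun x => f x + u
  have hgK : IntegrableOn g K := 
    Integrable.add (hf.mono_measure (Measure.restrict_mono hKD le_rfl))
      (integrableOn_const (hDfin K hKD).ne)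
  have hcurve := fun p : T => aux_curve (A p) (hAm p) ((hAK p).trans (hKD.trans hD1)) g
    (hgK.mono_set (hAK p)) p (2 * η) (by
      intro x hx
      have h1 : ‖f x - p‖ < η := by simpa [dist_eq_norm] using hx.2
      have h2 : g x - p = (f x - p) + u := by simp only [g]; abel
      rw [h2]
      refine (norm_add_le _ _).trans ?_
      linarith)
  choose x hx1 hx2 using hcurve
  let B : T → ℝ → Set ℝ := fun p s => A p ∩ Set.Iio (x p s)
  have hBA : ∀ p s, B p s ⊆ A p := fun p s => Set.inter_subset_left
  have hBm : ∀ p s, MeasurableSet (B p s) := fun p s => (hAm p).inter measurableSet_Iio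
  let F : (T → ℝ) → V := fun s => ∑ p : T, (∫ y in B p (s p), g y)
  let box : Set (T → ℝ) := {s | ∀ p, 0 ≤ s p ∧ s p ≤ m0 / 2}
  have happ : ApproximatesLinearOn (fun s => P (F s)) L box ⟨κ, hκ.le⟩ := by
    intro s hs t ht
    have h1 : P (F s) - P (F t) - L (s - t) = P (F s - F t - (L (s - t) : V)) := by
      rw [map_sub P, map_sub P, hP]
    have h2 : F s - F t - (L (s - t) : V) = ∑ p : T,
        ((∫ y in B p (s p), g y) - (∫ y in B p (t p), g y) - (s p - t p) • (p : V)) := by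
      rw [hL, Finset.sum_sub_distrib, Finset.sum_sub_distrib]
      rfl
    have h3 : ‖F s - F t - (L (s - t) : V)‖ ≤ n * (2 * η) * ‖s - t‖ := by
      rw [h2]
      refine (norm_sum_le_of_le _ (f := _) (n := fun _ => 2 * η * ‖s - t‖) ?_).trans ?_
      · intro p _
        have hA2 := hAvol p p.2
        refine (hx2 p (s p) (t p) (hs p).1 ((hs p).2.trans hA2) (ht p).1
          ((ht p).2.trans hA2)).trans ?_
        gcongr
        exact norm_le_pi_norm (s - t) p
      · simp only [Finset.sum_const, nsmul_eq_mul, Finset.card_univ, Fintype.card_coe]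
        rw [hn, mul_assoc, mul_assoc, mul_assoc]
    calc ‖P (F s) - P (F t) - L (s - t)‖ = ‖P (F s - F t - (L (s - t) : V))‖ := by rw [h1]
      _ ≤ ‖P‖ * ‖F s - F t - (L (s - t) : V)‖ := P.le_opNorm _
      _ ≤ ‖P‖ * (n * (2 * η) * ‖s - t‖) := by gcongr
      _ = ‖P‖ * (n * (2 * η)) * ‖s - t‖ := by ring
      _ ≤ κ * ‖s - t‖ := by gcongr
  let b : T → ℝ := fun p => τ * c p
  have hball : Metric.closedBall b (τ * c0) ⊆ box := by
    intro s hs p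
    have h1 : dist (s p) (b p) ≤ τ * c0 := (dist_le_pi_dist s b p).trans hs
    rw [Real.dist_eq, abs_le] at h1
    have h2 := mul_le_mul_of_nonneg_left (hc0' p p.2) hτ.le
    have h3 := mul_le_mul_of_nonneg_left (hC' p p.2) hτ.le
    simp only [b] at h1
    constructor <;> linarith
  have hbbox : b ∈ box := hball (Metric.mem_closedBall_self (by positivity))
  have h0box : (0 : T → ℝ) ∈ box := fun p => ⟨le_rfl, by simp only [Pi.zero_apply]; positivity⟩
  have hF0 : F 0 = 0 := by
    refine Finset.sum_eq_zero fun p _ => ?_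
    have h1 := hx1 p 0 le_rfl measureReal_nonneg
    have h2 : volume (B p 0) = 0 := by
      rwa [measureReal_eq_zero_iff (hDfin _ ((hBA p 0).trans ((hAK p).trans hKD))).ne] at h1
    exact setIntegral_measure_zero _ h2
  have hLb : L b = 0 := by
    apply Subtype.ext
    rw [hL, Finset.sum_coe_sort T (fun p => (τ * c p) • p)]
    simp only [mul_smul, ← Finset.smul_sum, hcsum, smul_zero, ZeroMemClass.coe_zero]
  have hbnorm : ‖b‖ ≤ τ * C := by
    rw [pi_norm_le_iff_of_nonneg (by positivity)]
    intro p
    rw [Real.norm_of_nonneg (mul_pos hτ (hc p p.2)).le]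
    exact mul_le_mul_of_nonneg_left (hC' p p.2) hτ.le
  have hGb : ‖P (F b)‖ ≤ I * (τ * c0) / 4 := by
    have h := happ b hbbox 0 h0box
    simp only [hF0, map_zero, sub_zero, hLb] at h
    refine h.trans ?_
    change κ * ‖b‖ ≤ _
    calc κ * ‖b‖ ≤ κ * (τ * C) := by gcongr
      _ = τ * (κ * C) := by ring
      _ ≤ τ * (I * c0 / 4) := by gcongr
      _ = _ := by ring
  have hv : ‖P (∫ y in K, g y)‖ ≤ I * (τ * c0) / 4 := by
    refine (P.le_opNorm _).trans (le_trans ?_ hR1)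
    gcongr
    have h1 : (∫ y in K, g y) = (∫ y in K, f y) + (∫ y in K, u) :=
      integral_add (hf.mono_measure (Measure.restrict_mono hKD le_rfl))
        (integrableOn_const (hDfin K hKD).ne)
    have h2 : (∫ y in D \ K, f y) = - (∫ y in K, f y) := by
      rw [setIntegral_sdiff hKm hf hKD, hmean, zero_sub]
    have h3 := hδ1' (D \ K) (hD.diff hKm) Set.sdiff_subset
      (hDK.trans_le (ENNReal.ofReal_le_ofReal d3))
    rw [h2, norm_neg] at h3
    rw [h1]
    refine (norm_add_le _ _).trans (add_le_add h3.le ?_)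
    rw [setIntegral_const, norm_smul, Real.norm_of_nonneg measureReal_nonneg]
    have h4 : volume.real K ≤ 1 := by
      have := measureReal_mono (μ := volume) (hKD.trans hD1) (by simp)
      simpa using this
    have := mul_le_mul h4 (hud.trans d2) (norm_nonneg u) zero_le_one
    linarith
  have hsurj := happ.surjOn_closedBall_of_nonlinearRightInverse N
    (show 0 ≤ τ * c0 by positivity) hball
  obtain ⟨s, hs, hsv⟩ := hsurj (show P (∫ y in K, g y) ∈ _ by
    rw [Metric.mem_closedBall, dist_eq_norm]
    refine (norm_sub_le _ _).trans ((add_le_add hv hGb).trans ?_)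
    change _ ≤ (I - κ) * (τ * c0)
    have : 0 < τ * c0 := by positivity
    nlinarith)
  have hsbox := hball hs
  have hopen : ∀ p : T, ∃ U, IsOpen U ∧ f ⁻¹' Metric.ball (p : V) η ∩ K = U ∩ K := fun p =>
    continuousOn_iff'.1 hKf _ Metric.isOpen_ball
  choose U hU hUK using hopen
  set E := K \ ⋃ p, B p (s p) with hE
  have hEU : E = K \ ⋃ p, (U p ∩ Set.Iio (x p (s p))) := by
    ext y
    simp only [hE, Set.mem_sdiff, Set.mem_iUnion, not_exists]
    refine and_congr_right fun hy => forall_congr' fun p => not_congr ?_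
    have h := Set.ext_iff.1 (hUK p) y
    simp only [Set.mem_inter_iff, hy, and_true] at h
    simp only [B, A, Set.mem_inter_iff, hy, true_and, h]
  have hBK : ∀ p s, B p s ⊆ K := fun p s => (hBA p s).trans (hAK p)
  have hUB : (⋃ p, B p (s p)) ⊆ K := Set.iUnion_subset fun p => hBK p _
  have hUBm : MeasurableSet (⋃ p, B p (s p)) := MeasurableSet.iUnion fun p => hBm p _
  have hdisj : Pairwise (Function.onFun Disjoint fun p => B p (s p)) := by
    intro p q hpq
    refine Set.disjoint_left.2 fun y hy hy' => ?_
    have h1 : dist (f y) p < η := (hBA _ _ hy).2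
    have h2 : dist (f y) q < η := (hBA _ _ hy').2
    have h3 := hη2' ((p : V), (q : V)) (Finset.mem_offDiag.2 ⟨p.2, q.2, fun h => hpq (Subtype.ext h)⟩)
    have h4 := dist_triangle_left (p : V) q (f y)
    simp only at h3
    linarith
  have hint : (∫ y in E, g y) = (∫ y in K, g y) - F s := by
    rw [hE, setIntegral_sdiff hUBm hgK hUB]
    congr 1
    rw [integral_iUnion (fun p => hBm p _) hdisj (hgK.mono_set hUB), tsum_fintype]
  have hED : E ⊆ D := Set.sdiff_subset.trans hKD
  have hgE : IntegrableOn g E := hgK.mono_set Set.sdiff_subset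
  have hPint : ((P (∫ y in E, g y) : W) : V) = (∫ y in E, g y) := by
    rw [← P.integral_comp_comm hgE, ← Submodule.subtypeL_apply,
      ← W.subtypeL.integral_comp_comm (P.integrable_comp hgE)]
    refine integral_congr_ae ?_
    filter_upwards [ae_restrict_of_ae_restrict_of_subset hED hfW] with y hy
    have : g y ∈ W := W.add_mem hy hu
    exact congrArg Subtype.val (hP ⟨g y, this⟩)
  refine ⟨E, ?_, Set.sdiff_subset.trans hKD', ?_, ?_, hKf.mono Set.sdiff_subset⟩
  · rw [hEU]
    exact hK.diff (isOpen_iUnion fun p => (hU p).inter isOpen_Iio)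
  · rw [ENNReal.lt_ofReal_iff_toReal_lt (hDfin _ Set.sdiff_subset).ne]
    change volume.real _ < ε
    have h1 : D \ E ⊆ (D \ K) ∪ ⋃ p, B p (s p) := by
      intro y hy
      by_cases h : y ∈ K
      · refine Or.inr ?_
        by_contra h'
        exact hy.2 ⟨h, h'⟩
      · exact Or.inl ⟨hy.1, h⟩
    have h2 : volume.real (D \ E) ≤ _ := measureReal_mono h1
      (hDfin _ (Set.union_subset Set.sdiff_subset (hUB.trans hKD))).ne
    have h3 := measureReal_union_le (μ := volume) (D \ K) (⋃ p, B p (s p))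
    have h4 : volume.real (⋃ p, B p (s p)) ≤ ∑ p, volume.real (B p (s p)) :=
      measureReal_iUnion_fintype_le _
    have h5 : ∑ p, volume.real (B p (s p)) ≤ ∑ p : T, 2 * (τ * C) := by
      refine Finset.sum_le_sum fun p _ => ?_
      have hb := hx1 p (s p) (hsbox p).1 ((hsbox p).2.trans (hAvol p p.2))
      change volume.real (A p ∩ Set.Iio (x p (s p))) ≤ _
      rw [hb]
      have h1 : dist (s p) (b p) ≤ τ * c0 := (dist_le_pi_dist s b p).trans hs
      rw [Real.dist_eq, abs_le] at h1
      have h2 := mul_le_mul_of_nonneg_left (hc0' p p.2) hτ.le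
      have h3 := mul_le_mul_of_nonneg_left (hC' p p.2) hτ.le
      simp only [b] at h1
      linarith
    simp only [Finset.sum_const, nsmul_eq_mul, Finset.card_univ, Fintype.card_coe] at h5
    rw [← hn] at h5
    linarith
  · change (∫ y in E, g y) = 0
    have hsv' : P (F s) = P (∫ y in K, g y) := hsv
    rw [← hPint, hint, map_sub, hsv', sub_self, ZeroMemClass.coe_zero]

theorem integral_on_subset {V : Type*} [NormedAddCommGroup V] [NormedSpace ℝ V]
    [FiniteDimensional ℝ V]
    (D : Set ℝ) (hD : MeasurableSet D) (hDpos : 0 < volume D) (hD1 : D ⊆ Set.Icc 0 1)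
    (f : ℝ → V) (hf : Integrable f (volume.restrict D))
    (hmean : ∫ x in D, f x = 0)
    (ε : ℝ) (hε : 0 < ε) :
    ∃ δ : ℝ, 0 < δ ∧
      ∀ D' : Set ℝ, MeasurableSet D' → D' ⊆ D →
        volume (D \ D') < ENNReal.ofReal δ →
        ∀ u ∈ Submodule.span ℝ (essRange (volume.restrict D) f), ‖u‖ ≤ δ →
          ∃ E : Set ℝ, IsCompact E ∧ E ⊆ D' ∧
            volume (D \ E) < ENNReal.ofReal ε ∧
            (∫ x in E, (f x + u)) = 0 ∧
            ContinuousOn f E := by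
  borelize V
  have hsm := hf.1
  set g := hsm.mk f with hg
  have hfg : f =ᵐ[volume.restrict D] g := hsm.ae_eq_mk
  have hgm : Measurable g := hsm.stronglyMeasurable_mk.measurable
  have hess : essRange (volume.restrict D) f = essRange (volume.restrict D) g := by
    ext r
    refine forall_congr' fun U => forall_congr' fun hU => ?_
    have : (f ⁻¹' U : Set ℝ) =ᵐ[volume.restrict D] (g ⁻¹' U : Set ℝ) := hfg.preimage U
    rw [measure_congr this]
  obtain ⟨δ, hδ, h⟩ := aux_core D hD hD1 g hgm (hf.congr hfg)
    (by rw [← integral_congr_ae hfg, hmean]) ε hε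
  refine ⟨δ, hδ, fun D' hD' hD'D hvol u hu hud => ?_⟩
  rw [hess] at hu
  obtain ⟨Z, hZ, hZm, hZ0⟩ := exists_measurable_superset_of_null (ae_iff.1 hfg)
  have hfgZ : ∀ x, x ∉ Z → f x = g x := by
    intro x hx
    by_contra hne
    exact hx (hZ hne)
  have hDZ : volume (D ∩ Z) = 0 := by
    rwa [Measure.restrict_apply hZm, Set.inter_comm] at hZ0
  obtain ⟨E, hE1, hE2, hE3, hE4, hE5⟩ := h (D' \ Z) (hD'.diff hZm) (Set.sdiff_subset.trans hD'D)
    (by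
      refine lt_of_le_of_lt ?_ hvol
      have : D \ (D' \ Z) ⊆ (D \ D') ∪ (D ∩ Z) := by
        intro y hy
        by_cases h : y ∈ D'
        · refine Or.inr ⟨hy.1, ?_⟩
          by_contra h'
          exact hy.2 ⟨h, h'⟩
        · exact Or.inl ⟨hy.1, h⟩
      refine (measure_mono this).trans ((measure_union_le _ _).trans ?_)
      rw [hDZ, add_zero]) u hu hud
  refine ⟨E, hE1, hE2.trans Set.sdiff_subset, hE3, ?_, ?_⟩
  · rw [← hE4]
    refine setIntegral_congr_fun hE1.measurableSet fun y hy => ?_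
    simp only [hfgZ y (hE2 hy).2]
  · exact hE5.congr fun y hy => hfgZ y (hE2 hy).2
end

section
/- Let $\{\mu_i\}_{i=1}^d$ be finite non-atomic signed measures on a measurable space $(\Omega,\Sigma)$. Then the set $\{(\mu_1(X),\dots,\mu_d(X)): X\in\Sigma\}$ is convex and compact in $\mathbb{R}^d$. -/
open MeasureTheory

namespace Lyap
variable {Ω : Type*} [MeasurableSpace Ω]

/-- Indicator as an element of L². -/
noncomputable def ind (ν : Measure Ω) [IsFiniteMeasure ν] (s : Set Ω) (hs : MeasurableSet s) :
    Lp ℝ 2 ν := indicatorConstLp 2 hs (measure_ne_top ν s) (1 : ℝ)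

lemma inner_ind (ν : Measure Ω) [IsFiniteMeasure ν] (s : Set Ω) (hs : MeasurableSet s)
    (f : Lp ℝ 2 ν) : inner ℝ (ind ν s hs) f = ∫ x in s, f x ∂ν :=
  L2.inner_indicatorConstLp_one hs (measure_ne_top ν s) f

lemma inner_ind' (ν : Measure Ω) [IsFiniteMeasure ν] (s : Set Ω) (hs : MeasurableSet s)
    (f : Lp ℝ 2 ν) : inner ℝ f (ind ν s hs) = ∫ x in s, f x ∂ν := by
  rw [real_inner_comm, inner_ind]

lemma ind_ae (ν : Measure Ω) [IsFiniteMeasure ν] (s : Set Ω) (hs : MeasurableSet s) :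
    ind ν s hs =ᵐ[ν] s.indicator (fun _ => (1 : ℝ)) := indicatorConstLp_coeFn

lemma lp_int (ν : Measure Ω) [IsFiniteMeasure ν] (g : Lp ℝ 2 ν) : Integrable g ν :=
  (Lp.memLp g).integrable (by norm_num)

/-- The functional represented by g. -/
noncomputable def rep (ν : Measure Ω) (g : Lp ℝ 2 ν) : WeakDual ℝ (Lp ℝ 2 ν) :=
  StrongDual.toWeakDual (InnerProductSpace.toDual ℝ (Lp ℝ 2 ν) g)

lemma rep_apply (ν : Measure Ω) (g f : Lp ℝ 2 ν) : rep ν g f = inner ℝ g f := rfl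

lemma rep_surj (ν : Measure Ω) (φ : WeakDual ℝ (Lp ℝ 2 ν)) : ∃ g, φ = rep ν g :=
  ⟨(InnerProductSpace.toDual ℝ (Lp ℝ 2 ν)).symm (WeakDual.toStrongDual φ), by simp [rep]⟩

lemma rep_add (ν : Measure Ω) (g f : Lp ℝ 2 ν) : rep ν (g + f) = rep ν g + rep ν f := by
  simp [rep]

lemma rep_sub (ν : Measure Ω) (g f : Lp ℝ 2 ν) : rep ν (g - f) = rep ν g - rep ν f := by
  simp [rep]

/-- Weak-* version of the order interval [0,1]. -/
def W (ν : Measure Ω) [IsFiniteMeasure ν] : Set (WeakDual ℝ (Lp ℝ 2 ν)) :=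
  {φ | ∀ s (hs : MeasurableSet s), 0 ≤ φ (ind ν s hs) ∧ φ (ind ν s hs) ≤ ν.real s}

lemma rep_mem (ν : Measure Ω) [IsFiniteMeasure ν] (g : Lp ℝ 2 ν) :
    rep ν g ∈ W ν ↔ ∀ᵐ x ∂ν, 0 ≤ g x ∧ g x ≤ 1 := by
  have hi := lp_int ν g
  have h1 : Integrable (fun _ : Ω => (1 : ℝ)) ν := integrable_const 1
  have h0 : Integrable (fun _ : Ω => (0 : ℝ)) ν := integrable_const 0
  simp only [W, Set.mem_setOf_eq, rep_apply, inner_ind']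
  constructor
  · intro h
    have a := ae_le_of_forall_setIntegral_le h0 hi (fun s hs _ => by simpa using (h s hs).1)
    have b := ae_le_of_forall_setIntegral_le hi h1 (fun s hs _ => by simpa using (h s hs).2)
    filter_upwards [a, b] with x ha hb using ⟨ha, hb⟩
  · intro h s hs
    constructor
    · apply setIntegral_nonneg_of_ae
      filter_upwards [h] with x hx using hx.1
    · have : ∫ x in s, g x ∂ν ≤ ∫ x in s, (1 : ℝ) ∂ν :=
        setIntegral_mono_ae hi.integrableOn h1.integrableOn (by
          filter_upwards [h] with x hx using hx.2)
      simpa using this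

lemma W_convex (ν : Measure Ω) [IsFiniteMeasure ν] : Convex ℝ (W ν) := by
  intro φ hφ ψ hψ a b ha hb hab s hs
  obtain ⟨h1, h2⟩ := hφ s hs
  obtain ⟨h3, h4⟩ := hψ s hs
  change 0 ≤ a * φ _ + b * ψ _ ∧ a * φ _ + b * ψ _ ≤ _
  constructor
  · positivity
  · calc _ ≤ a * ν.real s + b * ν.real s := by gcongr
      _ = _ := by rw [← add_mul, hab, one_mul]

lemma W_compact (ν : Measure Ω) [IsFiniteMeasure ν] : IsCompact (W ν) := by
  apply WeakDual.isCompact_of_bounded_of_closed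
  · have : W ν ⊆ WeakDual.toStrongDual ⁻¹' (Metric.closedBall 0 ‖ind ν Set.univ .univ‖) := by
      intro φ hφ
      obtain ⟨g, rfl⟩ := rep_surj ν φ
      rw [rep_mem] at hφ
      have : ‖g‖ ≤ ‖ind ν Set.univ .univ‖ := by
        apply Lp.norm_le_norm_of_ae_le
        filter_upwards [hφ, ind_ae ν Set.univ .univ] with x hx h1
        rw [h1]
        simp [abs_of_nonneg hx.1, hx.2]
      simpa [rep] using this
    exact (WeakDual.isBounded_toStrongDual_preimage_iff_isBounded.2
      Metric.isBounded_closedBall).subset this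
  · simp only [W, Set.setOf_forall, Set.setOf_and]
    refine isClosed_iInter fun s => isClosed_iInter fun hs => IsClosed.inter ?_ ?_
    · exact isClosed_le continuous_const (WeakDual.eval_continuous _)
    · exact isClosed_le (WeakDual.eval_continuous _) continuous_const

instance (ν : Measure Ω) : LocallyConvexSpace ℝ (WeakDual ℝ (Lp ℝ 2 ν)) :=
  inferInstanceAs (LocallyConvexSpace ℝ (WeakBilin (topDualPairing ℝ (Lp ℝ 2 ν))))

def NA (ν : Measure Ω) : Prop := ∀ E, MeasurableSet E → ν E ≠ 0 →
    ∃ Y ⊆ E, MeasurableSet Y ∧ ν Y ≠ 0 ∧ ν (E \ Y) ≠ 0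

lemma exists_disj {ν : Measure Ω} (h : NA ν) (n : ℕ) : ∀ E, MeasurableSet E → ν E ≠ 0 →
    ∃ A : Fin n → Set Ω, (∀ j, MeasurableSet (A j) ∧ A j ⊆ E ∧ ν (A j) ≠ 0) ∧
      Pairwise (fun j k => Disjoint (A j) (A k)) := by
  induction n with
  | zero => exact fun E _ _ => ⟨fun _ => ∅, fun j => j.elim0, fun j => j.elim0⟩
  | succ n ih =>
    intro E hE hE0
    obtain ⟨Y, hYE, hY, hY0, hEY⟩ := h E hE hE0
    obtain ⟨A, hA, hd⟩ := ih Y hY hY0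
    refine ⟨Fin.cons (E \ Y) A, ?_, ?_⟩
    · intro j
      refine Fin.cases ?_ (fun j => ?_) j
      · exact ⟨hE.diff hY, Set.diff_subset, hEY⟩
      · exact ⟨(hA j).1, (hA j).2.1.trans hYE, (hA j).2.2⟩
    · have key : ∀ k, Disjoint (E \ Y) (A k) := fun k =>
        Set.disjoint_sdiff_left.mono_right (hA k).2.1
      intro j k
      refine Fin.cases ?_ (fun j => ?_) j <;> refine Fin.cases ?_ (fun k => ?_) k
      · simp
      · intro _; simpa using key k
      · intro _; simpa using (key j).symm
      · intro hjk; simpa using hd (fun h => hjk (by rw [h]))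

lemma exists_ker {d : ℕ} (M : Fin (d + 1) → Fin d → ℝ) (ε : ℝ) (hε : 0 < ε) :
    ∃ c : Fin (d + 1) → ℝ, c ≠ 0 ∧ (∀ j, |c j| ≤ ε) ∧ ∀ i, ∑ j, c j * M j i = 0 := by
  have := LinearMap.ker_ne_bot_of_finrank_lt (K := ℝ) (f := Fintype.linearCombination ℝ M) (by simp)
  obtain ⟨c, hc, hc0⟩ := Submodule.exists_mem_ne_zero_of_ne_bot this
  have hn : 0 < ‖c‖ := norm_pos_iff.2 hc0
  refine ⟨(ε / ‖c‖) • c, by simp [hc0, hn.ne', hε.ne'], fun j => ?_, fun i => ?_⟩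
  · have := norm_le_pi_norm c j
    rw [Pi.smul_apply, smul_eq_mul, abs_mul, abs_of_pos (by positivity), div_mul_eq_mul_div,
      div_le_iff₀ hn]
    gcongr
    exact this
  · have := congrFun (LinearMap.mem_ker.1 hc) i
    simp only [Fintype.linearCombination_apply, Finset.sum_apply, Pi.smul_apply, smul_eq_mul,
      Pi.zero_apply] at this
    simp only [Pi.smul_apply, smul_eq_mul, mul_assoc, ← Finset.mul_sum, this, mul_zero]

lemma sum_ae (ν : Measure Ω) [IsFiniteMeasure ν] {n : ℕ} (A : Fin n → Set Ω)
    (hA : ∀ j, MeasurableSet (A j)) (hd : Pairwise (fun j k => Disjoint (A j) (A k)))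
    (E : Set Ω) (hE : ∀ j, A j ⊆ E) (c : Fin n → ℝ) (ε : ℝ) (hε : 0 < ε) (hc : ∀ j, |c j| ≤ ε) :
    ∀ᵐ x ∂ν, |(∑ j, c j • ind ν (A j) (hA j) : Lp ℝ 2 ν) x| ≤ E.indicator (fun _ => ε) x := by
  have h1 : ∀ᵐ x ∂ν, ∀ j, (c j • ind ν (A j) (hA j) : Lp ℝ 2 ν) x =
      c j * (A j).indicator (fun _ => (1 : ℝ)) x := by
    rw [ae_all_iff]
    intro j
    filter_upwards [ind_ae ν (A j) (hA j), Lp.coeFn_smul (c j) (ind ν (A j) (hA j))] with x h1 h2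
    rw [h2, Pi.smul_apply, h1, smul_eq_mul]
  have h2 : ((∑ j, c j • ind ν (A j) (hA j) : Lp ℝ 2 ν) : Ω → ℝ) =ᵐ[ν]
      fun x => ∑ j, (c j • ind ν (A j) (hA j) : Lp ℝ 2 ν) x := by
    generalize (Finset.univ : Finset (Fin n)) = S
    induction S using Finset.induction_on with
    | empty => simpa using! Lp.coeFn_zero ℝ 2 ν
    | insert a S ha ih =>
      rw [Finset.sum_insert ha]
      filter_upwards [Lp.coeFn_add (c a • ind ν (A a) (hA a)) (∑ j ∈ S, c j • ind ν (A j) (hA j)),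
        ih] with x hx hx2
      rw [hx, Pi.add_apply, hx2, Finset.sum_insert ha]
  filter_upwards [h1, h2] with x h1 h2
  rw [h2]
  simp only [h1]
  by_cases hx : ∃ k, x ∈ A k
  · obtain ⟨k, hk⟩ := hx
    rw [Finset.sum_eq_single k]
    · simpa [hk, hE k hk] using hc k
    · intro j _ hjk
      have : x ∉ A j := fun h => Set.disjoint_left.1 (hd hjk) h hk
      simp [this]
    · simp
  · push Not at hx
    simp only [Set.indicator_of_notMem (hx _), mul_zero, Finset.sum_const_zero, abs_zero]
    exact Set.indicator_nonneg (fun _ _ => hε.le) x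

lemma extreme_ae {ν : Measure Ω} [IsFiniteMeasure ν] (h : NA ν) {d : ℕ} (f : Fin d → Lp ℝ 2 ν)
    (v : Fin d → ℝ) (g : Lp ℝ 2 ν)
    (hg : rep ν g ∈ Set.extremePoints ℝ (W ν ∩ {φ | ∀ i, φ (f i) = v i})) :
    ∀ᵐ x ∂ν, g x = 0 ∨ g x = 1 := by
  have hgW := (rep_mem ν g).1 hg.1.1
  have hgv : ∀ i, rep ν g (f i) = v i := hg.1.2
  have hgm : Measurable (g : Ω → ℝ) := (Lp.stronglyMeasurable g).measurable
  -- it suffices that each slab is null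
  have key : ∀ n : ℕ, ν {x | 1 / ((n : ℝ) + 1) ≤ g x ∧ g x ≤ 1 - 1 / ((n : ℝ) + 1)} = 0 := by
    intro n
    by_contra hne
    set ε : ℝ := 1 / ((n : ℝ) + 1) with hε
    have hε0 : 0 < ε := by positivity
    set E : Set Ω := {x | ε ≤ g x ∧ g x ≤ 1 - ε} with hEdef
    have hE : MeasurableSet E :=
      (measurableSet_le measurable_const hgm).inter (measurableSet_le hgm measurable_const)
    obtain ⟨A, hA, hd⟩ := exists_disj h (d + 1) E hE hne
    obtain ⟨c, hc0, hcε, hck⟩ := exists_ker (fun j i => ∫ x in A j, f i x ∂ν) ε hε0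
    set H : Lp ℝ 2 ν := ∑ j, c j • ind ν (A j) (hA j).1 with hH
    have hHae := sum_ae ν A (fun j => (hA j).1) hd E (fun j => (hA j).2.1) c ε hε0 hcε
    have hHf : ∀ i, rep ν H (f i) = 0 := by
      intro i
      rw [rep_apply, hH, sum_inner, ← hck i]
      refine Finset.sum_congr rfl fun j _ => ?_
      rw [real_inner_smul_left, inner_ind]
    have hp : rep ν (g + H) ∈ W ν ∩ {φ | ∀ i, φ (f i) = v i} := by
      refine ⟨(rep_mem ν _).2 ?_, fun i => ?_⟩
      · filter_upwards [hgW, hHae, Lp.coeFn_add g H] with x h1 h2 h3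
        rw [h3, Pi.add_apply]
        by_cases hx : x ∈ E
        · rw [Set.indicator_of_mem hx, abs_le] at h2
          constructor <;> linarith [hx.1, hx.2, h2.1, h2.2]
        · rw [Set.indicator_of_notMem hx, abs_nonpos_iff] at h2
          rw [h2, add_zero]; exact h1
      · rw [rep_add]
        change rep ν g (f i) + rep ν H (f i) = _
        rw [hHf, hgv, add_zero]
    have hm : rep ν (g - H) ∈ W ν ∩ {φ | ∀ i, φ (f i) = v i} := by
      refine ⟨(rep_mem ν _).2 ?_, fun i => ?_⟩
      · filter_upwards [hgW, hHae, Lp.coeFn_sub g H] with x h1 h2 h3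
        rw [h3, Pi.sub_apply]
        by_cases hx : x ∈ E
        · rw [Set.indicator_of_mem hx, abs_le] at h2
          constructor <;> linarith [hx.1, hx.2, h2.1, h2.2]
        · rw [Set.indicator_of_notMem hx, abs_nonpos_iff] at h2
          rw [h2, sub_zero]; exact h1
      · rw [rep_sub]
        change rep ν g (f i) - rep ν H (f i) = _
        rw [hHf, hgv, sub_zero]
    have hseg : rep ν g ∈ openSegment ℝ (rep ν (g + H)) (rep ν (g - H)) := by
      refine ⟨1 / 2, 1 / 2, by norm_num, by norm_num, by norm_num, ?_⟩
      rw [rep_add, rep_sub]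
      module
    have heq := hg.2 hp hm hseg
    rw [rep_add, add_eq_left] at heq
    apply hc0
    funext k
    have h1 : rep ν H (ind ν (A k) (hA k).1) = 0 := by rw [heq]; rfl
    rw [rep_apply, hH, sum_inner, Finset.sum_eq_single k] at h1
    · rw [real_inner_smul_left, inner_ind, setIntegral_congr_ae (g := fun _ => (1 : ℝ)) (hA k).1]
        at h1
      · have : ν.real (A k) ≠ 0 := by
          rw [Measure.real, ENNReal.toReal_ne_zero]; exact ⟨(hA k).2.2, measure_ne_top _ _⟩
        simpa [this] using h1
      · filter_upwards [ind_ae ν (A k) (hA k).1] with x hx hxk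
        simp [hx, hxk]
    · intro j _ hjk
      rw [real_inner_smul_left, inner_ind, setIntegral_congr_ae (g := fun _ => (0 : ℝ)) (hA j).1]
      · simp
      · filter_upwards [ind_ae ν (A k) (hA k).1] with x hx hxj
        have : x ∉ A k := Set.disjoint_left.1 (hd hjk) hxj
        simp [hx, this]
    · simp
  have key' : ∀ᵐ x ∂ν, ∀ n : ℕ, ¬ (1 / ((n : ℝ) + 1) ≤ g x ∧ g x ≤ 1 - 1 / ((n : ℝ) + 1)) := by
    rw [ae_all_iff]
    intro n
    rw [ae_iff]
    simpa using key n
  filter_upwards [key', hgW] with x hx h01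
  by_contra! hcon
  have hpos : 0 < min (g x) (1 - g x) :=
    lt_min (lt_of_le_of_ne h01.1 (Ne.symm hcon.1)) (sub_pos.2 (lt_of_le_of_ne h01.2 hcon.2))
  obtain ⟨n, hn⟩ := exists_nat_one_div_lt hpos
  rw [lt_min_iff] at hn
  exact hx n ⟨hn.1.le, by linarith [hn.2]⟩

lemma range_eq {ν : Measure Ω} [IsFiniteMeasure ν] (h : NA ν) {d : ℕ} (f : Fin d → Lp ℝ 2 ν) :
    {v : Fin d → ℝ | ∃ X : Set Ω, MeasurableSet X ∧ v = fun i => ∫ x in X, f i x ∂ν} =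
      (fun (φ : WeakDual ℝ (Lp ℝ 2 ν)) i => φ (f i)) '' W ν := by
  ext v
  constructor
  · rintro ⟨X, hX, rfl⟩
    refine ⟨rep ν (ind ν X hX), (rep_mem ν _).2 ?_, ?_⟩
    · filter_upwards [ind_ae ν X hX] with x hx
      rw [hx]
      by_cases hxX : x ∈ X <;> simp [hxX]
    · funext i
      exact inner_ind ν X hX (f i)
  · rintro ⟨φ, hφ, rfl⟩
    have hcl : IsClosed {ψ : WeakDual ℝ (Lp ℝ 2 ν) | ∀ i, ψ (f i) = φ (f i)} := by
      simp only [Set.setOf_forall]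
      exact isClosed_iInter fun i => isClosed_eq (WeakDual.eval_continuous _) continuous_const
    obtain ⟨ψ, hψ⟩ := ((W_compact ν).inter_right hcl).extremePoints_nonempty
      ⟨φ, hφ, fun _ => rfl⟩
    obtain ⟨g, rfl⟩ := rep_surj ν ψ
    have hae := extreme_ae h f _ g hψ
    have hgm : Measurable (g : Ω → ℝ) := (Lp.stronglyMeasurable g).measurable
    have hX : MeasurableSet {x | g x = 1} := measurableSet_eq_fun hgm measurable_const
    refine ⟨{x | g x = 1}, hX, ?_⟩
    have hg : g = ind ν _ hX := by
      apply Lp.ext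
      filter_upwards [hae, ind_ae ν _ hX] with x h1 h2
      rw [h2]
      rcases h1 with h1 | h1 <;> simp [h1]
    funext i
    rw [← inner_ind ν _ hX, ← hg]
    exact (hψ.1.2 i).symm

lemma core {ν : Measure Ω} [IsFiniteMeasure ν] (h : NA ν) {d : ℕ} (f : Fin d → Lp ℝ 2 ν) :
    Convex ℝ {v : Fin d → ℝ | ∃ X : Set Ω, MeasurableSet X ∧ v = fun i => ∫ x in X, f i x ∂ν} ∧
    IsCompact {v : Fin d → ℝ | ∃ X : Set Ω, MeasurableSet X ∧
      v = fun i => ∫ x in X, f i x ∂ν} := by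
  rw [range_eq h]
  constructor
  · refine (W_convex ν).is_linear_image ⟨fun _ _ => rfl, fun _ _ => rfl⟩
  · exact (W_compact ν).image (continuous_pi fun i => WeakDual.eval_continuous _)

lemma tv_zero (s : SignedMeasure Ω) (E : Set Ω) (hE : MeasurableSet E)
    (h : ∀ Y ⊆ E, MeasurableSet Y → s Y = 0) : s.totalVariation E = 0 := by
  obtain ⟨i, hi₁, hi₂, hi₃, hpos, hneg⟩ := s.toJordanDecomposition_spec
  rw [SignedMeasure.totalVariation, Measure.add_apply, hpos, hneg,
    SignedMeasure.toMeasureOfZeroLE_apply _ _ _ hE, SignedMeasure.toMeasureOfLEZero_apply _ _ _ hE]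
  simp [h _ Set.inter_subset_right (hi₁.inter hE), h _ Set.inter_subset_right (hi₁.compl.inter hE)]

lemma abs_le_tv (s : SignedMeasure Ω) (E : Set Ω) (hE : MeasurableSet E) :
    |s E| ≤ s.totalVariation.real E := by
  have h : s E = s.toJordanDecomposition.posPart.real E - s.toJordanDecomposition.negPart.real E := by
    conv_lhs => rw [← SignedMeasure.toSignedMeasure_toJordanDecomposition s]
    rw [JordanDecomposition.toSignedMeasure, Measure.toSignedMeasure_sub_apply hE]
  rw [SignedMeasure.totalVariation, measureReal_add_apply, h, abs_le]
  constructor <;> linarith [@measureReal_nonneg _ _ s.toJordanDecomposition.posPart E,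
    @measureReal_nonneg _ _ s.toJordanDecomposition.negPart E]

lemma exists_density (s : SignedMeasure Ω) (ν : Measure Ω) [IsFiniteMeasure ν]
    (h : ∀ E, MeasurableSet E → |s E| ≤ ν.real E) :
    ∃ f : Lp ℝ 2 ν, ∀ E, MeasurableSet E → s E = ∫ x in E, f x ∂ν := by
  have hac : s ≪ᵥ ν.toENNRealVectorMeasure := by
    refine VectorMeasure.AbsolutelyContinuous.mk fun E hE h0 => ?_
    rw [Measure.toENNRealVectorMeasure_apply_measurable hE] at h0
    have := h E hE
    rw [Measure.real, h0] at this
    simpa using this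
  have hd := SignedMeasure.withDensityᵥ_rnDeriv_eq s ν hac
  have hi : Integrable (s.rnDeriv ν) ν := SignedMeasure.integrable_rnDeriv s ν
  have hs : ∀ E, MeasurableSet E → s E = ∫ x in E, s.rnDeriv ν x ∂ν := fun E hE => by
    conv_lhs => rw [← hd]
    exact withDensityᵥ_apply hi hE
  have h1 : ∀ᵐ x ∂ν, s.rnDeriv ν x ≤ 1 :=
    ae_le_of_forall_setIntegral_le hi (integrable_const 1) (fun E hE _ => by
      rw [← hs E hE]; simpa using (abs_le.1 (h E hE)).2)
  have h2 : ∀ᵐ x ∂ν, -1 ≤ s.rnDeriv ν x :=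
    ae_le_of_forall_setIntegral_le (integrable_const (-1)) hi (fun E hE _ => by
      rw [← hs E hE]; simpa using (abs_le.1 (h E hE)).1)
  have hm : MemLp (s.rnDeriv ν) 2 ν := MemLp.of_bound hi.aestronglyMeasurable 1 (by
    filter_upwards [h1, h2] with x h1 h2
    exact abs_le.2 ⟨h2, h1⟩)
  refine ⟨hm.toLp, fun E hE => ?_⟩
  rw [hs E hE]
  exact setIntegral_congr_ae hE (by filter_upwards [hm.coeFn_toLp] with x hx _ using hx.symm)

end Lyap

theorem lyapunov_convexity {Ω : Type*} [MeasurableSpace Ω] (d : ℕ)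
    (μ : Fin d → SignedMeasure Ω)
    (hna : ∀ i, ∀ X : Set Ω, MeasurableSet X → μ i X ≠ 0 →
      ∃ Y : Set Ω, Y ⊆ X ∧ MeasurableSet Y ∧ μ i Y ≠ 0 ∧ μ i Y ≠ μ i X) :
    Convex ℝ {v : Fin d → ℝ | ∃ X : Set Ω, MeasurableSet X ∧ v = fun i => μ i X} ∧
    IsCompact {v : Fin d → ℝ | ∃ X : Set Ω, MeasurableSet X ∧ v = fun i => μ i X} := by
  have hfin : ∀ i, IsFiniteMeasure (μ i).totalVariation := fun i => by
    rw [SignedMeasure.totalVariation]; infer_instance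
  let ν : Measure Ω := ∑ i, (μ i).totalVariation
  have hνf : IsFiniteMeasure ν := by
    refine ⟨?_⟩
    simp only [ν, Measure.finsetSum_apply]
    exact ENNReal.sum_lt_top.2 fun i _ => measure_lt_top _ _
  have hle : ∀ i E, (μ i).totalVariation E ≤ ν E := fun i E => by
    simp only [ν, Measure.finsetSum_apply]
    exact Finset.single_le_sum (f := fun i => (μ i).totalVariation E) (fun _ _ => zero_le)
      (Finset.mem_univ i)
  have habs : ∀ i E, MeasurableSet E → |μ i E| ≤ ν.real E := fun i E hE =>
    (Lyap.abs_le_tv (μ i) E hE).trans (ENNReal.toReal_mono (measure_ne_top _ _) (hle i E))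
  have hne : ∀ i E, MeasurableSet E → μ i E ≠ 0 → ν E ≠ 0 := fun i E hE h h0 => by
    have := habs i E hE
    rw [Measure.real, h0] at this
    exact h (by simpa using this)
  have hNA : Lyap.NA ν := by
    intro E hE hE0
    have : ∃ i, ∃ Y ⊆ E, MeasurableSet Y ∧ μ i Y ≠ 0 := by
      by_contra! hcon
      apply hE0
      simp only [ν, Measure.finsetSum_apply]
      exact Finset.sum_eq_zero fun i _ => Lyap.tv_zero _ E hE (hcon i)
    obtain ⟨i, X, hXE, hX, hX0⟩ := this
    obtain ⟨Y, hYX, hY, hY0, hYne⟩ := hna i X hX hX0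
    refine ⟨Y, hYX.trans hXE, hY, hne i Y hY hY0, fun h0 => ?_⟩
    refine hne i (X \ Y) (hX.diff hY) ?_ (measure_mono_null (Set.diff_subset_diff_left hXE) h0)
    have := VectorMeasure.of_add_of_sdiff (v := μ i) hY hX hYX
    intro h
    rw [h, add_zero] at this
    exact hYne this
  choose f hf using fun i => Lyap.exists_density (μ i) ν (habs i)
  have hset : {v : Fin d → ℝ | ∃ X : Set Ω, MeasurableSet X ∧ v = fun i => μ i X} =
      {v : Fin d → ℝ | ∃ X : Set Ω, MeasurableSet X ∧ v = fun i => ∫ x in X, f i x ∂ν} := by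
    ext v
    refine exists_congr fun X => and_congr_right fun hX => ?_
    simp only [hf _ X hX]
  rw [hset]
  exact Lyap.core hNA f
end

section
/- Let $x\in\mathbb{R}^n$ be such that $1,x_1,\dots,x_n$ are rationally independent and let $\varepsilon>0$. Then for every non-zero $v\in\mathbb{R}^n$ there exist an integer $q\ge 1$ and integers $p_1,\dots,p_n$ such that the vector $w$ with $w_l=\frac{p_l}{q}-x_l$ satisfies $\|w\|_\infty<\frac{\varepsilon}{q}$ and $(w,v)>0$. -/
open Finset

open MeasureTheory Filter Topology UnitAddTorus in
/-- Characters are multiplicative. -/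
lemma aux_mFourier_add_arg {n : ℕ} (k : Fin n → ℤ) (s t : UnitAddTorus (Fin n)) :
    mFourier k (s + t) = mFourier k s * mFourier k t := by
  simp [mFourier, fourier_apply, ← Finset.prod_mul_distrib, AddCircle.toCircle_add, smul_add]

open MeasureTheory Filter Topology UnitAddTorus in
lemma aux_mFourier_nsmul {n : ℕ} (k : Fin n → ℤ) (y : UnitAddTorus (Fin n)) (q : ℕ) :
    mFourier k (q • y) = mFourier k y ^ q := by
  induction q with
  | zero => simp [mFourier]
  | succ q ih => rw [succ_nsmul, aux_mFourier_add_arg, ih, pow_succ]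

open MeasureTheory Filter Topology UnitAddTorus in
lemma aux_integral {n : ℕ} (k : Fin n → ℤ) (y : UnitAddTorus (Fin n))
    (h : mFourier k y ≠ 1) : ∫ t, mFourier k t = 0 := by
  have h1 : ∫ t, mFourier k (y + t) = ∫ t, mFourier k t :=
    integral_add_left_eq_self (fun t => mFourier k t) y
  simp_rw [aux_mFourier_add_arg, integral_const_mul] at h1
  by_contra h0
  exact h (mul_right_cancel₀ h0 (by rw [h1, one_mul]))

open MeasureTheory in
lemma aux_vol {n : ℕ} : (volume : Measure (UnitAddTorus (Fin n))).real Set.univ = 1 := by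
  have : volume (Set.univ : Set (UnitAddTorus (Fin n))) = 1 := by
    change Measure.pi (fun _ : Fin n => (volume : Measure UnitAddCircle)) Set.univ = 1
    rw [Measure.pi_univ]
    simp
  rw [Measure.real, this, ENNReal.toReal_one]

open MeasureTheory Filter Topology UnitAddTorus in
lemma aux_weyl_char {n : ℕ} (k : Fin n → ℤ) (y : UnitAddTorus (Fin n))
    (h : k ≠ 0 → mFourier k y ≠ 1) :
    Tendsto (fun N : ℕ => (N : ℂ)⁻¹ * ∑ q ∈ range N, mFourier k ((q + 1) • y)) atTop
      (𝓝 (∫ t, mFourier k t)) := by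
  by_cases hk : k = 0
  · subst hk
    simp only [mFourier_zero, ContinuousMap.one_apply]
    refine tendsto_const_nhds.congr' ?_
    filter_upwards [eventually_ne_atTop 0] with N hN
    simp [hN, aux_vol]
  · have h' := h hk
    rw [aux_integral k y h']
    have hz : ‖mFourier k y‖ ≤ 1 := (ContinuousMap.norm_coe_le_norm _ _).trans mFourier_norm.le
    simp_rw [aux_mFourier_nsmul, pow_succ, ← Finset.sum_mul]
    set z := mFourier k y
    simp_rw [geom_sum_eq h']
    have hb : Tendsto (fun N : ℕ => (2 / ‖z - 1‖) * (N : ℝ)⁻¹) atTop (𝓝 0) := by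
      simpa using (tendsto_inv_atTop_nhds_zero_nat (𝕜 := ℝ)).const_mul (2 / ‖z - 1‖)
    refine squeeze_zero_norm (fun N => ?_) hb
    have h2 : ‖z ^ N - 1‖ ≤ 2 := by
      refine (norm_sub_le _ _).trans ?_
      rw [norm_pow, norm_one]
      linarith [pow_le_one₀ (n := N) (norm_nonneg z) hz]
    rw [norm_mul, norm_mul, norm_div, norm_inv, Complex.norm_natCast, mul_comm]
    gcongr
    calc _ ≤ ‖z ^ N - 1‖ / ‖z - 1‖ * 1 := by gcongr
      _ ≤ _ := by rw [mul_one]; gcongr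

open MeasureTheory Filter Topology UnitAddTorus in
lemma aux_weyl_span {n : ℕ} (y : UnitAddTorus (Fin n))
    (h : ∀ k : Fin n → ℤ, k ≠ 0 → mFourier k y ≠ 1) (g : C(UnitAddTorus (Fin n), ℂ))
    (hg : g ∈ Submodule.span ℂ (Set.range (mFourier (d := Fin n)))) :
    Tendsto (fun N : ℕ => (N : ℂ)⁻¹ * ∑ q ∈ range N, g ((q + 1) • y)) atTop
      (𝓝 (∫ t, g t)) := by
  have hint : ∀ g : C(UnitAddTorus (Fin n), ℂ), Integrable g := fun g =>
    g.continuous.integrable_of_hasCompactSupport (HasCompactSupport.of_compactSpace _)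
  induction hg using Submodule.span_induction with
  | mem g hg =>
    obtain ⟨k, rfl⟩ := hg
    exact aux_weyl_char k y (h k)
  | zero => simp
  | add f g _ _ hf hg =>
    have := hf.add hg
    simp only [ContinuousMap.add_apply, Finset.sum_add_distrib, mul_add]
    rwa [integral_add (hint f) (hint g)]
  | smul c f _ hf =>
    have := hf.const_mul c
    simp only [ContinuousMap.smul_apply, smul_eq_mul, ← Finset.mul_sum]
    rw [integral_const_mul]
    refine this.congr fun N => by ring

open MeasureTheory Filter Topology UnitAddTorus in
/-- Kronecker's theorem. -/
lemma aux_kronecker {n : ℕ} (y : UnitAddTorus (Fin n))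
    (h : ∀ k : Fin n → ℤ, k ≠ 0 → mFourier k y ≠ 1) (U : Set (UnitAddTorus (Fin n)))
    (hU : IsOpen U) (hne : U.Nonempty) : ∃ q : ℕ, (q + 1) • y ∈ U := by
  by_contra! hq
  obtain ⟨u, hu⟩ := hne
  obtain ⟨f, hf0, hf1, hf⟩ := exists_continuous_zero_one_of_isClosed hU.isClosed_compl
    (isClosed_singleton (x := u)) (by simpa using hu)
  have hint : ∀ g : C(UnitAddTorus (Fin n), ℂ), Integrable g := fun g =>
    g.continuous.integrable_of_hasCompactSupport (HasCompactSupport.of_compactSpace _)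
  have hpos : 0 < ∫ t, f t := by
    refine f.continuous.integral_pos_of_hasCompactSupport_nonneg_nonzero
      (HasCompactSupport.of_compactSpace _) (fun t => (hf t).1) (x := u) ?_
    have := hf1 (Set.mem_singleton u)
    simp [this]
  let F : C(UnitAddTorus (Fin n), ℂ) := ⟨fun t => (f t : ℂ), by fun_prop⟩
  have hF : ∫ t, F t = ((∫ t, f t : ℝ) : ℂ) := integral_ofReal
  set I := ∫ t, f t
  have hmem : F ∈ (Submodule.span ℂ (Set.range (mFourier (d := Fin n)))).topologicalClosure := by
    rw [span_mFourier_closure_eq_top]; trivial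
  rw [← SetLike.mem_coe, Submodule.topologicalClosure_coe, Metric.mem_closure_iff] at hmem
  obtain ⟨g, hg, hd⟩ := hmem (I / 2) (by positivity)
  rw [dist_comm, dist_eq_norm] at hd
  set η := ‖g - F‖
  have hη : ∀ t, ‖g t - F t‖ ≤ η := fun t => (g - F).norm_coe_le_norm t
  have h1 : ‖∫ t, g t‖ ≤ η := by
    refine le_of_tendsto (aux_weyl_span y h g hg).norm ?_
    filter_upwards [eventually_ne_atTop 0] with N hN
    have : ‖∑ q ∈ range N, g ((q + 1) • y)‖ ≤ N * η := by
      refine (norm_sum_le_of_le _ (n := fun _ => η) fun q _ => ?_).trans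
        (by rw [Finset.sum_const, Finset.card_range, nsmul_eq_mul])
      have h3 : F ((q + 1) • y) = 0 := by
        have := hf0 (show (q + 1) • y ∈ Uᶜ from hq q)
        simpa [F] using this
      simpa [h3] using hη ((q + 1) • y)
    rw [norm_mul, norm_inv, Complex.norm_natCast]
    have hN' : (0 : ℝ) < N := by positivity
    rw [inv_mul_le_iff₀ hN']
    exact this
  have h2 : ‖(∫ t, g t) - ∫ t, F t‖ ≤ η := by
    rw [← integral_sub (hint g) (hint F)]
    refine (norm_integral_le_of_norm_le_const (Eventually.of_forall hη)).trans ?_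
    rw [aux_vol, mul_one]
  have h3 : I ≤ ‖∫ t, g t‖ + ‖(∫ t, g t) - ∫ t, F t‖ := by
    calc I = ‖∫ t, F t‖ := by rw [hF, Complex.norm_real, Real.norm_of_nonneg hpos.le]
      _ = ‖(∫ t, g t) - ((∫ t, g t) - ∫ t, F t)‖ := by rw [sub_sub_cancel]
      _ ≤ _ := norm_sub_le _ _
  linarith

open UnitAddTorus in
theorem aux_char_ne_one {n : ℕ} (x : Fin n → ℝ)
    (hind : ∀ (c0 : ℤ) (c : Fin n → ℤ),
      (c0 : ℝ) + ∑ i, (c i : ℝ) * x i = 0 → c0 = 0 ∧ ∀ i, c i = 0)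
    (k : Fin n → ℤ) (hk : k ≠ 0) :
    mFourier k (fun i => ((-x i : ℝ) : UnitAddCircle)) ≠ 1 := by
  intro h
  apply hk
  simp only [mFourier, ContinuousMap.coe_mk, fourier_coe_apply, ← Complex.exp_sum] at h
  rw [Complex.exp_eq_one_iff] at h
  obtain ⟨m, hm⟩ := h
  have h2 : (∑ i, (k i : ℂ) * (-x i)) * (2 * Real.pi * Complex.I)
      = m * (2 * Real.pi * Complex.I) := by
    rw [← hm, Finset.sum_mul]
    refine Finset.sum_congr rfl fun i _ => ?_
    push_cast
    ring
  have h3 := mul_right_cancel₀ Complex.two_pi_I_ne_zero h2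
  have h4 : ∑ i, (k i : ℝ) * (-x i) = m := by exact_mod_cast h3
  have h5 := hind m k (by rw [← h4, ← Finset.sum_add_distrib]; simp)
  funext i
  exact h5.2 i

theorem diophantine_approximation_directed (n : ℕ) (x : Fin n → ℝ)
    (hind : ∀ (c0 : ℤ) (c : Fin n → ℤ),
      (c0 : ℝ) + ∑ i, (c i : ℝ) * x i = 0 → c0 = 0 ∧ ∀ i, c i = 0)
    (ε : ℝ) (hε : 0 < ε)
    (v : Fin n → ℝ) (hv : v ≠ 0) :
    ∃ (q : ℕ) (p : Fin n → ℤ), 1 ≤ q ∧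
      (∀ l, |(p l : ℝ) / q - x l| < ε / q) ∧
      0 < ∑ l, ((p l : ℝ) / q - x l) * v l := by
  let W : Set (Fin n → ℝ) := {w | (∀ l, |w l| < ε) ∧ 0 < ∑ l, w l * v l}
  have hW : IsOpen W := by
    have h1 : IsOpen (⋂ l, {w : Fin n → ℝ | |w l| < ε}) :=
      isOpen_iInter_of_finite fun l => isOpen_lt (by fun_prop) (by fun_prop)
    have h2 : IsOpen {w : Fin n → ℝ | 0 < ∑ l, w l * v l} :=
      isOpen_lt (by fun_prop) (by fun_prop)
    convert h1.inter h2 using 1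
    ext w
    simp [W]
  have hWne : W.Nonempty := by
    have hvn : 0 < ‖v‖ := norm_pos_iff.mpr hv
    obtain ⟨i, hi⟩ := Function.ne_iff.mp hv
    have hs : 0 < ∑ l, v l * v l :=
      Finset.sum_pos' (fun l _ => mul_self_nonneg _) ⟨i, Finset.mem_univ _, mul_self_pos.mpr hi⟩
    refine ⟨fun l => ε / (2 * ‖v‖) * v l, fun l => ?_, ?_⟩
    · rw [abs_mul, abs_of_pos (by positivity)]
      have := norm_le_pi_norm v l
      rw [Real.norm_eq_abs] at this
      calc _ ≤ ε / (2 * ‖v‖) * ‖v‖ := by gcongr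
        _ = ε / 2 := by field_simp
        _ < ε := by linarith
    · simp_rw [mul_assoc, ← Finset.mul_sum]
      positivity
  have hop : IsOpenMap (Pi.map (fun (_ : Fin n) (t : ℝ) => (t : UnitAddCircle))) :=
    IsOpenMap.piMap (fun _ => QuotientAddGroup.isOpenMap_coe)
      (Filter.Eventually.of_forall fun _ => QuotientAddGroup.mk_surjective)
  obtain ⟨q, w, ⟨hw1, hw2⟩, hw⟩ := aux_kronecker _ (aux_char_ne_one x hind) _ (hop W hW)
    (hWne.image _)
  have hp : ∀ l, ∃ p : ℤ, w l = p - (q + 1 : ℕ) * x l := by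
    intro l
    have h1 := congrFun hw l
    have h2 : ((w l + (q + 1) • x l : ℝ) : UnitAddCircle) = 0 := by
      rw [AddCircle.coe_add, AddCircle.coe_nsmul]
      simp only [Pi.map_apply, Pi.smul_apply] at h1
      rw [h1, AddCircle.coe_neg, smul_neg, neg_add_cancel]
    rw [AddCircle.coe_eq_zero_iff] at h2
    obtain ⟨m, hm⟩ := h2
    refine ⟨m, ?_⟩
    rw [zsmul_eq_mul, mul_one, nsmul_eq_mul] at hm
    linarith
  choose p hp using hp
  have hq : (0 : ℝ) < (q + 1 : ℕ) := by positivity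
  have key : ∀ l, (p l : ℝ) / (q + 1 : ℕ) - x l = w l / (q + 1 : ℕ) := by
    intro l
    rw [hp l]; field_simp
  refine ⟨q + 1, p, by omega, fun l => ?_, ?_⟩
  · rw [key, abs_div, abs_of_pos hq]
    gcongr
    exact hw1 l
  · simp_rw [key, div_mul_eq_mul_div, ← Finset.sum_div]
    positivity
end

section
/- Let $\Omega_n=\{1,\dots,n\}$ with counting measure, $V$ a finite-dimensional real normed space with Steinitz constant $S_V$, and $f:\Omega_n\to V$ with $\sum_{i=1}^n f(i)=0$. Then there exist a cyclic permutation $\sigma$ of $\Omega_n$ and a function $g:\Omega_n\to V$ with $\max_i\|g(i)\|\le S_V\max_i\|f(i)\|$ such that $f=g\circ\sigma-g$. -/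
open Finset

/-- `S` is a Steinitz bound for `V`: every mean zero finite family admits a permutation
with all partial sums bounded by `S` times the max norm. -/
def IsSteinitzBound (V : Type*) [NormedAddCommGroup V] [NormedSpace ℝ V] (S : ℝ) : Prop :=
  ∀ (m : ℕ) (v : Fin m → V), ∑ i, v i = 0 →
    ∃ π : Equiv.Perm (Fin m),
      ∀ k : Fin m, ‖∑ i ∈ Finset.Iic k, v (π i)‖ ≤ S * ⨆ i, ‖v i‖

/-- The Steinitz constant of `V`: the smallest Steinitz bound. -/
noncomputable def SteinitzConst (V : Type*) [NormedAddCommGroup V] [NormedSpace ℝ V] : ℝ :=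
  sInf {S : ℝ | IsSteinitzBound V S}

/-- Basic feasible solution: weights with few fractional entries. -/
lemma exists_few_frac {ι W : Type*} [Fintype ι] [NormedAddCommGroup W]
    [NormedSpace ℝ W] [FiniteDimensional ℝ W] (w : ι → W) (l : ι → ℝ)
    (hl : ∀ i, l i ∈ Set.Icc (0:ℝ) 1) :
    ∃ μ : ι → ℝ, (∀ i, μ i ∈ Set.Icc (0:ℝ) 1) ∧ ∑ i, μ i • w i = ∑ i, l i • w i ∧
      (Finset.univ.filter (fun i => 0 < μ i ∧ μ i < 1)).card ≤ Module.finrank ℝ W := by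
  classical
  let K : Set (ι → ℝ) := (Set.univ.pi fun _ => Set.Icc (0:ℝ) 1) ∩
    {μ | ∑ i, μ i • w i = ∑ i, l i • w i}
  have hK : IsCompact K := by
    apply (isCompact_univ_pi fun _ => isCompact_Icc).inter_right
    apply isClosed_eq
    · fun_prop
    · fun_prop
  have hne : K.Nonempty := ⟨l, fun i _ => hl i, rfl⟩
  obtain ⟨μ, hμ⟩ := hK.extremePoints_nonempty hne
  have hμK : μ ∈ K := hμ.1
  refine ⟨μ, fun i => hμK.1 i trivial, hμK.2, ?_⟩
  by_contra! hcard
  set F := Finset.univ.filter (fun i => 0 < μ i ∧ μ i < 1) with hF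
  have hdep : ¬ LinearIndependent ℝ (fun i : F => w i) := by
    intro h
    have := h.fintype_card_le_finrank
    simp only [Fintype.card_coe] at this
    omega
  rw [Fintype.not_linearIndependent_iff] at hdep
  obtain ⟨t, ht, i0, hi0⟩ := hdep
  let T : ι → ℝ := fun i => if h : i ∈ F then t ⟨i, h⟩ else 0
  have hT : ∑ i, T i • w i = 0 := by
    rw [← ht, ← Finset.sum_subset (Finset.subset_univ F)
      (fun i _ hi => by simp [T, hi]), ← Finset.sum_coe_sort F]
    exact Finset.sum_congr rfl fun i _ => by simp [T]
  have hev : ∀ᶠ ε in nhds (0:ℝ), ∀ i, μ i + ε * T i ∈ Set.Icc (0:ℝ) 1 := by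
    rw [Filter.eventually_all]
    intro i
    by_cases hi : i ∈ F
    · have hi' : 0 < μ i ∧ μ i < 1 := by simpa [hF] using hi
      have hc : Filter.Tendsto (fun ε : ℝ => μ i + ε * T i) (nhds 0) (nhds (μ i)) := by
        have : Continuous (fun ε : ℝ => μ i + ε * T i) := by fun_prop
        simpa using this.tendsto 0
      exact hc (Icc_mem_nhds hi'.1 hi'.2)
    · have : T i = 0 := by simp [T, hi]
      simp only [this, mul_zero, add_zero]
      exact Filter.Eventually.of_forall fun _ => hμK.1 i trivial
  obtain ⟨r, hr, hball⟩ := Metric.eventually_nhds_iff.1 hev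
  have mem : ∀ ε : ℝ, |ε| < r → (fun i => μ i + ε * T i) ∈ K := by
    intro ε hε
    refine ⟨fun i _ => hball (by simpa using hε) i, ?_⟩
    have h2 := hμK.2
    simp only [Set.mem_ofPred_eq] at h2 ⊢
    simp only [add_smul, mul_smul, Finset.sum_add_distrib, ← Finset.smul_sum, hT, h2]
    simp
  have hx := mem (r/2) (by rw [abs_of_pos (by positivity)]; linarith)
  have hy := mem (-(r/2)) (by rw [abs_neg, abs_of_pos (by positivity)]; linarith)
  have := hμ.2 hx hy ⟨1/2, 1/2, by norm_num, by norm_num, by norm_num, by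
    ext i; simp; ring⟩
  have h3 := congrFun this i0
  have h4 : T i0 = t i0 := by simp [T]
  simp only [h4] at h3
  have : r / 2 * t i0 = 0 := by linarith
  rcases mul_eq_zero.1 this with h | h
  · linarith
  · exact hi0 h

/-- The invariant of the Grinberg-Sevastyanov argument. -/
def GSInv {ι V : Type*} [NormedAddCommGroup V] [NormedSpace ℝ V] (d : ℕ) (v : ι → V)
    (A : Finset ι) : Prop :=
  A.card ≤ d ∨ ∃ l : ι → ℝ, (∀ i ∈ A, l i ∈ Set.Icc (0:ℝ) 1) ∧
    ∑ i ∈ A, l i = A.card - d ∧ ∑ i ∈ A, l i • v i = 0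

lemma GSInv.norm_le {ι V : Type*} [NormedAddCommGroup V] [NormedSpace ℝ V] {d : ℕ} {v : ι → V}
    {A : Finset ι} (h : GSInv d v A) {M : ℝ} (hM0 : 0 ≤ M) (hM : ∀ i, ‖v i‖ ≤ M) :
    ‖∑ i ∈ A, v i‖ ≤ d * M := by
  rcases h with h | ⟨l, h1, h2, h3⟩
  · calc ‖∑ i ∈ A, v i‖ ≤ ∑ i ∈ A, M := norm_sum_le_of_le _ fun i _ => hM i
      _ = A.card * M := by simp
      _ ≤ d * M := by gcongr
  · have : ∑ i ∈ A, v i = ∑ i ∈ A, (1 - l i) • v i := by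
      simp [sub_smul, Finset.sum_sub_distrib, h3]
    rw [this]
    calc ‖∑ i ∈ A, (1 - l i) • v i‖ ≤ ∑ i ∈ A, (1 - l i) * M := by
          apply norm_sum_le_of_le
          intro i hi
          have := (h1 i hi).2
          rw [norm_smul, Real.norm_of_nonneg (by linarith)]
          exact mul_le_mul_of_nonneg_left (hM i) (by linarith)
      _ = d * M := by
          rw [← Finset.sum_mul, Finset.sum_sub_distrib, h2]
          simp

lemma GSInv.step {ι V : Type*} [DecidableEq ι] [NormedAddCommGroup V] [NormedSpace ℝ V]
    [FiniteDimensional ℝ V] {v : ι → V}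
    {A : Finset ι} (h : GSInv (Module.finrank ℝ V) v A) (hA : A.Nonempty) :
    ∃ i ∈ A, GSInv (Module.finrank ℝ V) v (A.erase i) := by
  set d := Module.finrank ℝ V with hd
  by_cases hk : A.card ≤ d + 1
  · obtain ⟨i, hi⟩ := hA
    refine ⟨i, hi, Or.inl ?_⟩
    rw [Finset.card_erase_of_mem hi]; omega
  rcases h with h | ⟨l, h1, h2, h3⟩
  · omega
  push Not at hk
  have hk' : (d:ℝ) + 1 < A.card := by exact_mod_cast hk
  let c : ℝ := (A.card - 1 - d) / (A.card - d)
  have hc0 : 0 ≤ c := div_nonneg (by linarith) (by linarith)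
  have hc1 : c ≤ 1 := (div_le_one (by linarith)).2 (by linarith)
  obtain ⟨μ, m1, m2, m3⟩ := exists_few_frac (W := V × ℝ) (fun i : A => (v i, (1:ℝ)))
    (fun i => c * l i) (fun i => ⟨mul_nonneg hc0 (h1 i i.2).1,
      mul_le_one₀ hc1 (h1 i i.2).1 (h1 i i.2).2⟩)
  have e1 : ∑ i : A, μ i • v i = 0 := by
    have := congrArg Prod.fst m2
    simp only [Prod.fst_sum, Prod.smul_fst, mul_smul, ← Finset.smul_sum] at this
    rw [this, Finset.sum_coe_sort A (fun i => l i • v i), h3, smul_zero]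
  have e2 : ∑ i : A, μ i = A.card - 1 - d := by
    have := congrArg Prod.snd m2
    simp only [Prod.snd_sum, Prod.smul_snd, smul_eq_mul, mul_one, ← Finset.mul_sum] at this
    rw [this, Finset.sum_coe_sort A l, h2]
    exact div_mul_cancel₀ _ (by linarith)
  have hz : ∃ i : A, μ i = 0 := by
    by_contra! hne
    set F := Finset.univ.filter (fun i => 0 < μ i ∧ μ i < 1) with hF
    have s1 : ∑ i : A, (1 - μ i) = d + 1 := by
      rw [Finset.sum_sub_distrib, e2]; simp; ring
    have s2 : ∑ i ∈ F, (1 - μ i) = ∑ i : A, (1 - μ i) := by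
      apply Finset.sum_subset (Finset.subset_univ _)
      intro i _ hi
      have a := m1 i
      have b : 0 < μ i := lt_of_le_of_ne a.1 (hne i).symm
      by_contra hh
      exact hi (by simp only [hF, Finset.mem_filter, Finset.mem_univ, true_and]
                   exact ⟨b, lt_of_le_of_ne a.2 fun h => hh (by linarith)⟩)
    have hFne : F.Nonempty := by
      by_contra hh
      rw [Finset.not_nonempty_iff_eq_empty] at hh
      rw [hh, Finset.sum_empty, s1] at s2
      have : (0:ℝ) ≤ d := Nat.cast_nonneg _
      linarith
    have s3 : ∑ i ∈ F, (1 - μ i) < ∑ i ∈ F, (1:ℝ) := by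
      apply Finset.sum_lt_sum_of_nonempty hFne
      intro i hi
      have := (Finset.mem_filter.1 hi).2.1
      linarith
    rw [s2, s1] at s3
    have m3' : (F.card : ℝ) ≤ d + 1 := by
      have : F.card ≤ d + 1 := by simpa [hd] using m3
      exact_mod_cast this
    simp at s3
    linarith
  obtain ⟨i, hi⟩ := hz
  let L : ι → ℝ := fun j => if h : j ∈ A then μ ⟨j, h⟩ else 0
  have hL : ∀ j : A, L j = μ j := fun j => by simp [L]
  have hLi : L i = 0 := by rw [hL, hi]
  refine ⟨i, i.2, Or.inr ⟨L, ?_, ?_, ?_⟩⟩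
  · intro j hj
    have := m1 ⟨j, Finset.mem_of_mem_erase hj⟩
    rwa [← hL] at this
  · rw [Finset.sum_erase _ hLi, Finset.card_erase_of_mem i.2, ← Finset.sum_coe_sort A L]
    simp only [hL, e2]
    rw [Nat.cast_sub (by omega)]; simp
  · rw [Finset.sum_erase _ (by simp [hLi]), ← Finset.sum_coe_sort A (fun j => L j • v j)]
    simp only [hL, e1]

lemma GSInv.order {ι V : Type*} [DecidableEq ι] [Inhabited ι] [NormedAddCommGroup V]
    [NormedSpace ℝ V]
    [FiniteDimensional ℝ V] {v : ι → V} {M : ℝ} (hM0 : 0 ≤ M) (hM : ∀ i, ‖v i‖ ≤ M) (n : ℕ) :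
    ∀ A : Finset ι, A.card = n → GSInv (Module.finrank ℝ V) v A →
    ∃ p : ℕ → ι, (Finset.range n).image p = A ∧
      ∀ k ≤ n, ‖∑ i ∈ Finset.range k, v (p i)‖ ≤ Module.finrank ℝ V * M := by
  induction n with
  | zero =>
    intro A hA _
    refine ⟨fun _ => default, ?_, ?_⟩
    · simp [Finset.card_eq_zero.1 hA]
    · intro k hk
      obtain rfl : k = 0 := by omega
      simp; positivity
  | succ n ih =>
    intro A hA h
    obtain ⟨i, hi, h'⟩ := h.step (Finset.card_pos.1 (by omega))
    obtain ⟨p, hp, hb⟩ := ih (A.erase i) (by rw [Finset.card_erase_of_mem hi]; omega) h'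
    have hq : ∀ j, j < n → Function.update p n i j = p j := fun j hj =>
      Function.update_of_ne (by omega) _ _
    have him : (Finset.range (n+1)).image (Function.update p n i) = A := by
      rw [Finset.range_add_one, Finset.image_insert, Function.update_self]
      rw [Finset.image_congr (g := p) (fun j hj => hq j (by simpa using hj)), hp,
        Finset.insert_erase hi]
    refine ⟨Function.update p n i, him, ?_⟩
    intro k hk
    rcases Nat.lt_or_ge n k with hkn | hkn
    · obtain rfl : k = n + 1 := by omega
      have hinj : Set.InjOn (Function.update p n i) (Finset.range (n+1)) := by
        apply Finset.injOn_of_card_image_eq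
        rw [him, hA, Finset.card_range]
      rw [← Finset.sum_image (f := v) hinj, him]
      exact h.norm_le hM0 hM
    · rw [Finset.sum_congr rfl fun j hj => by
        rw [hq j (by have := Finset.mem_range.1 hj; omega)]]
      exact hb k hkn

lemma steinitz (V : Type*) [NormedAddCommGroup V] [NormedSpace ℝ V] [FiniteDimensional ℝ V] :
    IsSteinitzBound V (Module.finrank ℝ V) := by
  intro m v hv
  rcases m with _ | m
  · exact ⟨1, fun k => k.elim0⟩
  have hM : ∀ i, ‖v i‖ ≤ ⨆ i, ‖v i‖ := fun i =>
    le_ciSup (f := fun i => ‖v i‖) (Set.finite_range _).bddAbove i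
  have hM0 : 0 ≤ ⨆ i, ‖v i‖ := (norm_nonneg _).trans (hM 0)
  have h0 : GSInv (Module.finrank ℝ V) v Finset.univ := by
    by_cases hc : m + 1 ≤ Module.finrank ℝ V
    · left; simpa using hc
    · right
      push Not at hc
      have hc' : (Module.finrank ℝ V : ℝ) < m + 1 := by exact_mod_cast hc
      have hd0 : (0:ℝ) ≤ Module.finrank ℝ V := Nat.cast_nonneg _
      refine ⟨fun _ => (m + 1 - Module.finrank ℝ V) / (m + 1), ?_, ?_, ?_⟩
      · intro i _
        exact ⟨div_nonneg (by linarith) (by linarith), (div_le_one (by linarith)).2 (by linarith)⟩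
      · simp; field_simp
      · rw [← Finset.smul_sum, hv, smul_zero]
  obtain ⟨p, hp, hb⟩ := GSInv.order hM0 hM (m+1) Finset.univ (by simp) h0
  have hsurj : Function.Surjective (fun i : Fin (m+1) => p i) := by
    intro y
    have : y ∈ (Finset.range (m+1)).image p := by rw [hp]; simp
    obtain ⟨j, hj, rfl⟩ := Finset.mem_image.1 this
    exact ⟨⟨j, Finset.mem_range.1 hj⟩, rfl⟩
  refine ⟨Equiv.ofBijective _ (Finite.surjective_iff_bijective.1 hsurj), fun k => ?_⟩
  have : ∑ i ∈ Finset.Iic k, v (Equiv.ofBijective _ (Finite.surjective_iff_bijective.1 hsurj) i)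
      = ∑ i ∈ Finset.range (k+1), v (p i) := by
    apply Finset.sum_bij (fun (i : Fin (m+1)) _ => (i : ℕ))
    · intro a ha; simp at ha ⊢; omega
    · intro a _ b _ h; exact Fin.ext h
    · intro b hb
      have := Finset.mem_range.1 hb
      exact ⟨⟨b, by omega⟩, by simp [Fin.le_def]; omega, rfl⟩
    · intro a _; rfl
  rw [this]
  exact hb _ (by omega)

/-- The Steinitz constant is attained for each family. -/
lemma steinitzConst_spec {V : Type*} [NormedAddCommGroup V] [NormedSpace ℝ V]
    [FiniteDimensional ℝ V] (m : ℕ) (v : Fin m → V) (hv : ∑ i, v i = 0) :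
    ∃ π : Equiv.Perm (Fin m),
      ∀ k : Fin m, ‖∑ i ∈ Finset.Iic k, v (π i)‖ ≤ SteinitzConst V * ⨆ i, ‖v i‖ := by
  have hM : ∀ i, ‖v i‖ ≤ ⨆ i, ‖v i‖ := fun i =>
    le_ciSup (f := fun i => ‖v i‖) (Set.finite_range _).bddAbove i
  have hM0 : 0 ≤ ⨆ i, ‖v i‖ := Real.iSup_nonneg fun _ => norm_nonneg _
  rcases hM0.eq_or_lt with h0 | h0
  · refine ⟨1, fun k => ?_⟩
    have : ∀ i, v i = 0 := fun i => norm_le_zero_iff.1 (h0 ▸ hM i)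
    simp [this]
  · by_contra! hcon
    choose k hk using hcon
    obtain ⟨π₀, hπ₀⟩ := Finite.exists_min
      (fun π : Equiv.Perm (Fin m) => ‖∑ i ∈ Finset.Iic (k π), v (π i)‖)
    have : ‖∑ i ∈ Finset.Iic (k π₀), v (π₀ i)‖ / (⨆ i, ‖v i‖) ≤ SteinitzConst V := by
      apply le_csInf ⟨_, steinitz V⟩
      intro S hS
      obtain ⟨π, hπ⟩ := hS m v hv
      rw [div_le_iff₀ h0]
      exact (hπ₀ π).trans (hπ _)
    rw [div_le_iff₀ h0] at this
    exact absurd (hk π₀) (not_lt.2 this)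

open scoped Fin.CommRing in
lemma finRotate_pow_sub (m : ℕ) (x y : Fin (m+1)) :
    ((finRotate (m+1)) ^ (y - x).val) x = y := by
  have hpow : ∀ (k : ℕ) (x : Fin (m+1)), ((finRotate (m+1)) ^ k) x = x + (k : Fin (m+1)) := by
    intro k
    induction k with
    | zero => simp
    | succ k ih =>
      intro x
      rw [pow_succ', Equiv.Perm.mul_apply, ih, finRotate_apply]
      push_cast
      ring
  rw [hpow, Fin.cast_val_eq_self]
  ring

theorem coboundary_on_finite_space {V : Type*} [NormedAddCommGroup V] [NormedSpace ℝ V]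
    [FiniteDimensional ℝ V]
    (n : ℕ) (hn : 0 < n) (f : Fin n → V) (hsum : ∑ i, f i = 0) :
    ∃ (σ : Equiv.Perm (Fin n)) (g : Fin n → V),
      (∀ x y : Fin n, ∃ k : ℕ, (σ ^ k) x = y) ∧
      (∀ i, ‖g i‖ ≤ SteinitzConst V * ⨆ i, ‖f i‖) ∧
      ∀ i, f i = g (σ i) - g i := by
  obtain ⟨π, hπ⟩ := steinitzConst_spec n f hsum
  obtain ⟨m, rfl⟩ : ∃ m, n = m + 1 := ⟨n - 1, by omega⟩
  let s : Fin (m+1) → V := fun k => ∑ i ∈ Finset.Iic k, f (π i)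
  have hs : ∀ j, f (π (finRotate (m+1) j)) = s (finRotate (m+1) j) - s j := by
    intro j
    rw [finRotate_apply]
    induction j using Fin.lastCases with
    | last =>
      have h1 : s (Fin.last m) = 0 := by
        have : Finset.Iic (Fin.last m) = Finset.univ := by ext; simp [Fin.le_last]
        simp only [s, this]
        rw [Equiv.sum_comp π f, hsum]
      have h2 : Finset.Iic (0 : Fin (m+1)) = {0} := by ext; simp
      rw [h1, Fin.last_add_one]
      simp [s, h2]
    | cast i =>
      rw [Fin.coeSucc_eq_succ]
      have : Finset.Iic i.succ = insert i.succ (Finset.Iic i.castSucc) := by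
        ext x
        simp [Fin.le_def, Fin.ext_iff]; omega
      simp only [s, this]
      rw [Finset.sum_insert (by simp [Fin.le_def])]
      abel
  -- index shift: `σ (π k) = π (k + 1)`
  have hconj : ∀ k : ℕ, (π * finRotate (m+1) * π⁻¹) ^ k = π * (finRotate (m+1)) ^ k * π⁻¹ :=
    fun k => conj_pow
  refine ⟨π * finRotate (m+1) * π⁻¹, fun x => s ((finRotate (m+1)).symm (π⁻¹ x)), ?_, ?_, ?_⟩
  · intro x y
    refine ⟨(π⁻¹ y - π⁻¹ x).val, ?_⟩
    rw [hconj]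
    rw [Equiv.Perm.mul_apply, Equiv.Perm.mul_apply, finRotate_pow_sub]
    simp
  · intro i
    exact hπ _
  · intro x
    have := hs ((finRotate (m+1)).symm (π⁻¹ x))
    simpa [Equiv.Perm.mul_apply] using this
end
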